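/- arXiv:2001.08039 — 8 statements merged into one kernel-verified Lean document; each statement's English description precedes it below -/
import Mathlib

section
/- For every x ∈ (0, 2/3) the following hold: (i) the set {s > x : cos(πs/2) = cos(πx/2)} has a minimum, equal to 4 − x; (ii) the set {s > 4 − x : cos(3πs/2) = cos(3π(4−x)/2)} has a minimum, equal to 4 + x. Consequently, writing P_−^0(x) := min{s > x : cos(πs/2) = cos(πx/2)} and P_+^0(x) := min{s > x : cos(3πs/2) = cos(3πx/2)}, the composition P(x,0) := P_+^0(P_−^0(x)) satisfies P(x,0) = x + 4 for every x ∈ (0,2/3), i.e. the undamped return map is 4-periodic on (0,2/3). -/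
open Real Set

/-- Undamped first-return map in the lower half-plane (frequency ω = 1/2):
the next zero after `x` of the undamped solution, i.e. the next `s > x`
with `cos(πs/2) = cos(πx/2)`. -/
noncomputable def Pm0 (x : ℝ) : ℝ :=
  sInf {s : ℝ | x < s ∧ Real.cos (π * s / 2) = Real.cos (π * x / 2)}

/-- Undamped first-return map in the upper half-plane (frequency ω = 3/2). -/
noncomputable def Pp0 (x : ℝ) : ℝ :=
  sInf {s : ℝ | x < s ∧ Real.cos (3 * π * s / 2) = Real.cos (3 * π * x / 2)}

/-- If `cos (c * π * s) = cos (c * π * t)`, then `c * s` and `c * t` agree up to sign modulo `2`. -/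
theorem exists_int_of_cos_mul_pi_eq {c s t : ℝ}
    (h : Real.cos (c * π * s) = Real.cos (c * π * t)) :
    ∃ k : ℤ, c * t = 2 * k + c * s ∨ c * t = 2 * k - c * s := by
  obtain ⟨k, hk | hk⟩ := Real.cos_eq_cos_iff.1 h
  · exact ⟨k, .inl (mul_right_cancel₀ Real.pi_ne_zero (by linear_combination hk))⟩
  · exact ⟨k, .inr (mul_right_cancel₀ Real.pi_ne_zero (by linear_combination hk))⟩

theorem isLeast_lower_return {x : ℝ} (hx : x ∈ Set.Ioo (0 : ℝ) 2) :
    IsLeast {s : ℝ | x < s ∧ Real.cos (π * s / 2) = Real.cos (π * x / 2)} (4 - x) := by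
  obtain ⟨h0, h1⟩ := hx
  refine ⟨⟨by linarith, Real.cos_eq_cos_iff.2 ⟨1, .inr (by push_cast; ring)⟩⟩, ?_⟩
  rintro s ⟨hs, hcos⟩
  obtain ⟨k, hk | hk⟩ := exists_int_of_cos_mul_pi_eq (c := 1 / 2) (s := s) (t := x)
    (by convert hcos using 2 <;> ring)
  · have hk_neg : (k : ℝ) < 0 := by linarith
    have hk_le : (k : ℝ) ≤ -1 := by
      exact_mod_cast Int.le_sub_one_of_lt (by exact_mod_cast hk_neg : k < 0)
    linarith
  · have hk_pos : (0 : ℝ) < k := by linarith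
    have hk_ge : (1 : ℝ) ≤ k := by
      exact_mod_cast Int.add_one_le_of_lt (by exact_mod_cast hk_pos : 0 < k)
    linarith

theorem isLeast_upper_return {x : ℝ} (hx : x ∈ Set.Ioo (0 : ℝ) (2 / 3)) :
    IsLeast {s : ℝ | 4 - x < s ∧
      Real.cos (3 * π * s / 2) = Real.cos (3 * π * (4 - x) / 2)} (4 + x) := by
  obtain ⟨h0, h1⟩ := hx
  refine ⟨⟨by linarith, Real.cos_eq_cos_iff.2 ⟨6, .inr (by push_cast; ring)⟩⟩, ?_⟩
  rintro s ⟨hs, hcos⟩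
  obtain ⟨k, hk | hk⟩ := exists_int_of_cos_mul_pi_eq (c := 3 / 2) (s := s) (t := 4 - x)
    (by convert hcos using 2 <;> ring)
  · have hk_neg : (k : ℝ) < 0 := by linarith
    have hk_le : (k : ℝ) ≤ -1 := by
      exact_mod_cast Int.le_sub_one_of_lt (by exact_mod_cast hk_neg : k < 0)
    linarith
  · have hk_gt : (5 : ℝ) < k := by linarith
    have hk_ge : (6 : ℝ) ≤ k := by
      exact_mod_cast Int.add_one_le_of_lt (by exact_mod_cast hk_gt : 5 < k)
    linarith

/-- for every `x ∈ (0, 2/3)`, the set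
`{s > x : cos(πs/2) = cos(πx/2)}` has minimum `4 − x`, the set
`{s > 4 − x : cos(3πs/2) = cos(3π(4−x)/2)}` has minimum `4 + x`, and hence
the composed undamped return map satisfies `P₊⁰(P₋⁰(x)) = x + 4`. -/
theorem undamped_return_map_is_4_periodic :
    ∀ x ∈ Set.Ioo (0 : ℝ) (2 / 3),
      IsLeast {s : ℝ | x < s ∧ Real.cos (π * s / 2) = Real.cos (π * x / 2)} (4 - x) ∧
      IsLeast {s : ℝ | 4 - x < s ∧
          Real.cos (3 * π * s / 2) = Real.cos (3 * π * (4 - x) / 2)} (4 + x) ∧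
      Pp0 (Pm0 x) = x + 4 := by
  intro x hx
  have hlower := isLeast_lower_return (x := x) ⟨hx.1, by linarith [hx.2]⟩
  have hupper := isLeast_upper_return hx
  refine ⟨hlower, hupper, ?_⟩
  have hPm0 : Pm0 x = 4 - x := hlower.csInf_eq
  rw [hPm0, add_comm]
  exact hupper.csInf_eq
end

section
/- There exists x₀ ∈ (1/2, 2/3) such that 32/(9π) + (2x₀/3)·cot(3πx₀/2) + (4 − 2x₀)·cot(πx₀/2) = 0. -/
open Real Set

/-- there exists `x₀ ∈ (1/2, 2/3)` with
`32/(9π) + (2x₀/3)·cot(3πx₀/2) + (4 − 2x₀)·cot(πx₀/2) = 0`. -/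
theorem exists_root_of_crossing_equation :
    ∃ x₀ ∈ Set.Ioo (1 / 2 : ℝ) (2 / 3),
      32 / (9 * π) + (2 * x₀ / 3) * Real.cot (3 * π * x₀ / 2)
        + (4 - 2 * x₀) * Real.cot (π * x₀ / 2) = 0 := by
  -- Clearing the sines makes the expression continuous up to the pole at `2 / 3`.
  let g : ℝ → ℝ := fun x =>
    32 / (9 * π) * (sin (3 * π * x / 2) * sin (π * x / 2))
      + 2 * x / 3 * (cos (3 * π * x / 2) * sin (π * x / 2))
      + (4 - 2 * x) * (cos (π * x / 2) * sin (3 * π * x / 2))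
  have hg : Continuous g := by fun_prop
  have hleft : 0 < g (1 / 2) := by
    have h₁ : π * (1 / 2) / 2 = π / 4 := by ring
    have h₃ : 3 * π * (1 / 2) / 2 = π - π / 4 := by ring
    have hsq : √2 / 2 * (√2 / 2) = (1 / 2 : ℝ) := by
      linear_combination Real.mul_self_sqrt (zero_le_two (α := ℝ)) / 4
    have hval : g (1 / 2) = 32 / (9 * π) * (1 / 2) + 4 / 3 := by
      simp only [g, h₁, h₃, sin_pi_sub, cos_pi_sub, sin_pi_div_four, cos_pi_div_four, neg_mul, hsq]
      ring
    rw [hval]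
    positivity
  have hright : g (2 / 3) < 0 := by
    have h₁ : π * (2 / 3) / 2 = π / 3 := by ring
    have h₃ : 3 * π * (2 / 3) / 2 = π := by ring
    have hval : g (2 / 3) = -(4 / 9 * (√3 / 2)) := by
      simp only [g, h₁, h₃, sin_pi, cos_pi, sin_pi_div_three]
      ring
    rw [hval, neg_lt_zero]
    positivity
  obtain ⟨x, hx, hgx⟩ :=
    intermediate_value_Ioo' (by norm_num : (1 / 2 : ℝ) ≤ 2 / 3) hg.continuousOn ⟨hright, hleft⟩
  have hx_pos : 0 < x := by linarith [hx.1]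
  have hs₁ : sin (π * x / 2) ≠ 0 :=
    (sin_pos_of_pos_of_lt_pi (by positivity) (by nlinarith [pi_pos, hx.2])).ne'
  have hs₃ : sin (3 * π * x / 2) ≠ 0 :=
    (sin_pos_of_pos_of_lt_pi (by positivity) (by nlinarith [pi_pos, hx.2])).ne'
  refine ⟨x, hx, ?_⟩
  rw [Real.cot_eq_cos_div_sin, Real.cot_eq_cos_div_sin]
  refine (mul_eq_zero.mp (Eq.trans ?_ hgx)).resolve_right (mul_ne_zero hs₃ hs₁)
  simp only [g]
  generalize sin (3 * π * x / 2) = s₃ at *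
  generalize sin (π * x / 2) = s₁ at *
  field_simp
end

section
/- Let a > 0, ω > 0 and x_i ∈ ℝ with sin(ωπx_i) ≠ 0, let Y_{a,ω,x_i} be the solution of y′ = −a·y − sin(ωπx) with y(x_i) = 0, and suppose x* := min{x > x_i : Y_{a,ω,x_i}(x) = 0} exists and satisfies sin(ωπx*) ≠ 0. Then there is a neighbourhood U of x_i on which the first-return map P(x) := min{s > x : Y_{a,ω,x}(s) = 0} is well defined and differentiable, and P′(x_i) = e^{−a(P(x_i)−x_i)} · sin(ωπx_i)/sin(ωπP(x_i)). -/
open Real Set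

/-- A `C¹` function is locally invertible near a point of nonzero derivative, and the
inverse is differentiable on a neighbourhood. -/
theorem exists_eventually_inverse_hasDerivAt {F f : ℝ → ℝ} (hF : ∀ x, HasDerivAt F (f x) x)
    (hf : Continuous f) {q : ℝ} (hq : f q ≠ 0) :
    ∃ g : ℝ → ℝ, (∀ᶠ x in nhds q, g (F x) = x) ∧
      (∀ᶠ y in nhds (F q), F (g y) = y ∧ HasDerivAt g (f (g y))⁻¹ y) := by
  have hstrict (x : ℝ) : HasStrictDerivAt F (f x) x :=
    hasStrictDerivAt_of_hasDerivAt_of_continuousAt (.of_forall hF) hf.continuousAt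
  have hleft := (hstrict q).eventually_left_inverse hq
  refine ⟨_, hleft, ?_⟩
  rw [← (hstrict q).map_nhds_eq hq, Filter.eventually_map]
  filter_upwards [hleft, hleft.eventually_nhds, hf.continuousAt.eventually_ne hq]
    with x hx hx' hne
  rw [hx]
  exact ⟨rfl, ((hstrict x).to_local_left_inverse hne hx').hasDerivAt⟩

/-- The first-return map to the level sets of a `C¹` function is differentiable near a point
where the level set is left and reached transversally. -/
theorem exists_firstReturn_hasDerivAt {F f : ℝ → ℝ} (hF : ∀ x, HasDerivAt F (f x) x)
    (hf : Continuous f) {p q : ℝ} (hp : f p ≠ 0) (hq : f q ≠ 0)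
    (hpq : IsLeast {s | p < s ∧ F s = F p} q) :
    ∃ P : ℝ → ℝ, P p = q ∧ ∀ᶠ x in nhds p,
      IsLeast {s | x < s ∧ F s = F x} (P x) ∧ HasDerivAt P (f x / f (P x)) x := by
  obtain ⟨⟨hlt, heq⟩, hmin⟩ := hpq
  obtain ⟨g, hg, hgF⟩ := exists_eventually_inverse_hasDerivAt hF hf hq
  obtain ⟨h, hh, -⟩ := exists_eventually_inverse_hasDerivAt hF hf hp
  have hcF : Continuous F := continuous_iff_continuousAt.2 fun x => (hF x).continuousAt
  have hgp : g (F p) = q := by rw [← heq]; exact hg.self_of_nhds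
  rw [heq] at hgF
  have hPt : Filter.Tendsto (fun x => g (F x)) (nhds p) (nhds q) := by
    have hgc : ContinuousAt g (F p) := hgF.self_of_nhds.2.continuousAt
    simpa only [ContinuousAt, Function.comp_def, hgp] using
      ContinuousAt.comp (f := F) hgc hcF.continuousAt
  obtain ⟨δ, hδ, hδh⟩ := Metric.eventually_nhds_iff.1 hh
  obtain ⟨ε, hε, hεg⟩ := Metric.eventually_nhds_iff.1 hg
  have hK : IsClosed (F '' Icc (p + δ) (q - ε)) := (isCompact_Icc.image hcF).isClosed
  have hpK : F p ∉ F '' Icc (p + δ) (q - ε) := by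
    rintro ⟨s, ⟨h₁, h₂⟩, hs⟩
    have : q ≤ s := hmin ⟨by linarith, hs⟩
    linarith
  refine ⟨fun x => g (F x), hgp, ?_⟩
  filter_upwards [hcF.continuousAt.eventually hgF,
    hcF.continuousAt.eventually (hK.isOpen_compl.mem_nhds hpK),
    Metric.ball_mem_nhds p hδ, hPt.eventually (Metric.ball_mem_nhds q hε),
    Filter.Tendsto.eventually_lt continuousAt_id hPt hlt] with x hx hxK hxp hxq hxlt
  refine ⟨⟨⟨hxlt, hx.1⟩, ?_⟩, ?_⟩
  · rintro s ⟨hxs, hs⟩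
    by_contra! hsP
    rw [Real.ball_eq_Ioo] at hxp
    have hPq := (abs_sub_lt_iff.1 hxq).1
    refine hxK ⟨s, ⟨?_, ?_⟩, hs⟩
    · by_contra! hsp
      have h₁ := hδh (y := s) (abs_sub_lt_iff.2 ⟨by linarith, by linarith [hxp.1]⟩)
      have h₂ := hδh (y := x) (abs_sub_lt_iff.2 ⟨by linarith [hxp.2], by linarith [hxp.1]⟩)
      rw [hs, h₂] at h₁
      exact hxs.ne h₁
    · by_contra! hsq
      have h₁ := hεg (y := s) (abs_sub_lt_iff.2 ⟨by linarith, by linarith⟩)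
      rw [hs] at h₁
      exact hsP.ne' h₁
  · convert! hx.2.comp x (hF x) using 1
    ring

/-- differentiability of the first-return map and the formula
`P′(x_i) = e^{−a(P(x_i)−x_i)}·sin(ωπx_i)/sin(ωπP(x_i))`.

Here `Y x_i` denotes the solution of `y′(x) = −a·y(x) − sin(ωπx)` with
`y(x_i) = 0` (hypothesised via `hY0`, `hYode`), and the first-return map `P`
sends `x` to the least `s > x` with `Y x s = 0`. -/
theorem first_return_map_differentiable (a ω : ℝ) (ha : 0 < a) (hω : 0 < ω)
    (Y : ℝ → ℝ → ℝ)
    (hY0 : ∀ xi : ℝ, Y xi xi = 0)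
    (hYode : ∀ xi x : ℝ, HasDerivAt (Y xi) (-a * Y xi x - Real.sin (ω * π * x)) x)
    (xi xstar : ℝ)
    (hsin_i : Real.sin (ω * π * xi) ≠ 0)
    (hstar : IsLeast {x : ℝ | xi < x ∧ Y xi x = 0} xstar)
    (hsin_star : Real.sin (ω * π * xstar) ≠ 0) :
    ∃ U ∈ nhds xi, ∃ P : ℝ → ℝ,
      (∀ x ∈ U, IsLeast {s : ℝ | x < s ∧ Y x s = 0} (P x)) ∧
      (∀ x ∈ U, DifferentiableAt ℝ P x) ∧
      HasDerivAt P
        (Real.exp (-a * (P xi - xi)) * Real.sin (ω * π * xi) / Real.sin (ω * π * P xi)) xi := by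
  have hexp (x : ℝ) : HasDerivAt (fun t => Real.exp (a * t)) (Real.exp (a * x) * a) x := by
    simpa using ((hasDerivAt_id x).const_mul a).exp
  have hderiv (x s : ℝ) : HasDerivAt (fun t => Real.exp (a * t) * Y x t)
      (-(Real.exp (a * s) * Real.sin (ω * π * s))) s := by
    convert! (hexp s).mul (hYode x s) using 1
    ring
  set F : ℝ → ℝ := fun t => Real.exp (a * t) * Y 0 t
  have hzero (x s : ℝ) : Y x s = 0 ↔ F s = F x := by
    have hd : ∀ t, HasDerivAt (fun t => F t - Real.exp (a * t) * Y x t) 0 t := fun t => by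
      convert! (hderiv 0 t).sub (hderiv x t) using 1
      ring
    have hconst := is_const_of_deriv_eq_zero (fun t => (hd t).differentiableAt)
      (fun t => (hd t).deriv) s x
    simp only [hY0, mul_zero, sub_zero] at hconst
    rw [← hconst, ← sub_eq_zero (a := F s), sub_sub_cancel, mul_eq_zero, or_iff_right (Real.exp_ne_zero _)]
  simp only [hzero] at hstar ⊢
  obtain ⟨P, rfl, hP⟩ := exists_firstReturn_hasDerivAt (hderiv 0) (by fun_prop)
    (neg_ne_zero.2 (mul_ne_zero (Real.exp_ne_zero _) hsin_i))
    (neg_ne_zero.2 (mul_ne_zero (Real.exp_ne_zero _) hsin_star)) hstar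
  refine ⟨_, hP, P, fun x hx => hx.1, fun x hx => hx.2.differentiableAt, ?_⟩
  convert! hP.self_of_nhds.2 using 1
  rw [show -a * (P xi - xi) = a * xi - a * P xi by ring, Real.exp_sub]
  field_simp
end

section
/- There exists a_l > 0 such that for every a ∈ (0, a_l): the composed first-return map P(x,a) := P_+^a(P_−^a(x)) is well defined for x near some x* ∈ (0, 2/3), there exists μ > 0 with P(x*,a) = x* + 4 and |P(x,a) − 4 − x*| < |x − x*| for all x with 0 < |x − x*| < μ (so x* is a locally asymptotically stable fixed point of the period-4 return map x ↦ P(x,a) − 4), Y_{a,1/2,x*}(x) < 0 for x ∈ (x*, P_−^a(x*)) and Y_{a,3/2,P_−^a(x*)}(x) > 0 for x ∈ (P_−^a(x*), x* + 4), and the function equal to Y_{a,1/2,x*} on [x*, P_−^a(x*)] and to Y_{a,3/2,P_−^a(x*)} on [P_−^a(x*), x* + 4] extends to a continuous 4-periodic function on ℝ. In other words, for all sufficiently small a > 0 the linear switching system has a non-sliding, locally asymptotically stable 4-periodic solution. -/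
open Real Set

/-- The unique solution of `y′(x) = −a·y(x) − sin(ωπx)` with `y(x_i) = 0`
(explicit formula). -/
noncomputable def Ysol (a ω xi x : ℝ) : ℝ :=
  (ω * π * Real.cos (ω * π * x) - a * Real.sin (ω * π * x)
    + Real.exp (-a * (x - xi)) * (a * Real.sin (ω * π * xi) - ω * π * Real.cos (ω * π * xi)))
    / (ω ^ 2 * π ^ 2 + a ^ 2)

/-- First-return map through the upper half-plane (frequency ω₊ = 3/2):
the next zero after `x_i` of the solution leaving the threshold at `x_i`. -/
noncomputable def Pp (a xi : ℝ) : ℝ := sInf {x : ℝ | xi < x ∧ Ysol a (3 / 2) xi x = 0}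

/-- First-return map through the lower half-plane (frequency ω₋ = 1/2). -/
noncomputable def Pm (a xi : ℝ) : ℝ := sInf {x : ℝ | xi < x ∧ Ysol a (1 / 2) xi x = 0}

/-- The integrating-factor primitive whose level sets determine the zeros of `Ysol`. -/
noncomputable def levelFun (a ω x : ℝ) : ℝ :=
  Real.exp (a * x) * (ω * π * Real.cos (ω * π * x) - a * Real.sin (ω * π * x))

lemma Ysol_eq_levelFun (a ω xi x : ℝ) :
    Ysol a ω xi x = Real.exp (-(a * x)) / (ω ^ 2 * π ^ 2 + a ^ 2)
      * (levelFun a ω x - levelFun a ω xi) := by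
  have h1 : Real.exp (-(a * x)) * Real.exp (a * x) = 1 := by
    rw [← Real.exp_add]; simp
  have h2 : Real.exp (-a * (x - xi)) = Real.exp (-(a * x)) * Real.exp (a * xi) := by
    rw [← Real.exp_add]; ring_nf
  unfold Ysol levelFun
  rw [h2, div_mul_eq_mul_div]
  congr 1
  linear_combination (-(ω * π * Real.cos (ω * π * x) - a * Real.sin (ω * π * x))) * h1

lemma Ysol_factor_pos {a : ℝ} (ha : 0 < a) (ω x : ℝ) :
    0 < Real.exp (-(a * x)) / (ω ^ 2 * π ^ 2 + a ^ 2) := by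
  positivity

lemma Ysol_eq_zero_iff {a : ℝ} (ha : 0 < a) (ω xi x : ℝ) :
    Ysol a ω xi x = 0 ↔ levelFun a ω x = levelFun a ω xi := by
  rw [Ysol_eq_levelFun, mul_eq_zero, sub_eq_zero]
  simp [(Ysol_factor_pos ha ω x).ne']

lemma Ysol_neg_iff {a : ℝ} (ha : 0 < a) (ω xi x : ℝ) :
    Ysol a ω xi x < 0 ↔ levelFun a ω x < levelFun a ω xi := by
  rw [Ysol_eq_levelFun, ← smul_eq_mul, smul_neg_iff_of_pos_left (Ysol_factor_pos ha ω x), sub_neg]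

lemma Ysol_pos_iff {a : ℝ} (ha : 0 < a) (ω xi x : ℝ) :
    0 < Ysol a ω xi x ↔ levelFun a ω xi < levelFun a ω x := by
  rw [Ysol_eq_levelFun, mul_pos_iff_of_pos_left (Ysol_factor_pos ha ω x), sub_pos]

lemma hasDerivAt_levelFun (a ω x : ℝ) :
    HasDerivAt (levelFun a ω)
      (-(ω ^ 2 * π ^ 2 + a ^ 2) * Real.exp (a * x) * Real.sin (ω * π * x)) x := by
  have h1 : HasDerivAt (fun x : ℝ => a * x) a x := by
    simpa using (hasDerivAt_id x).const_mul a
  have h2 : HasDerivAt (fun x : ℝ => ω * π * x) (ω * π) x := by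
    simpa using (hasDerivAt_id x).const_mul (ω * π)
  have h := h1.exp.mul ((h2.cos.const_mul (ω * π)).sub (h2.sin.const_mul a))
  refine h.congr_deriv ?_
  simp only [Pi.sub_apply]
  ring

lemma continuous_levelFun (a ω : ℝ) : Continuous (levelFun a ω) := by
  unfold levelFun
  fun_prop

lemma strictMonoOn_levelFun {a ω p q : ℝ} (ha : 0 < a)
    (h : ∀ x ∈ Ioo p q, Real.sin (ω * π * x) < 0) : StrictMonoOn (levelFun a ω) (Icc p q) := by
  refine strictMonoOn_of_deriv_pos (convex_Icc p q) (continuous_levelFun a ω).continuousOn ?_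
  intro x hx
  rw [interior_Icc] at hx
  rw [(hasDerivAt_levelFun a ω x).deriv]
  have : 0 < (ω ^ 2 * π ^ 2 + a ^ 2) * Real.exp (a * x) := by positivity
  nlinarith [mul_neg_of_pos_of_neg this (h x hx)]

lemma strictAntiOn_levelFun {a ω p q : ℝ} (ha : 0 < a)
    (h : ∀ x ∈ Ioo p q, 0 < Real.sin (ω * π * x)) : StrictAntiOn (levelFun a ω) (Icc p q) := by
  refine strictAntiOn_of_deriv_neg (convex_Icc p q) (continuous_levelFun a ω).continuousOn ?_
  intro x hx
  rw [interior_Icc] at hx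
  rw [(hasDerivAt_levelFun a ω x).deriv]
  have : 0 < (ω ^ 2 * π ^ 2 + a ^ 2) * Real.exp (a * x) := by positivity
  nlinarith [mul_pos this (h x hx)]

lemma strictAntiOn_levelFun_half {a : ℝ} (ha : 0 < a) :
    StrictAntiOn (levelFun a (1 / 2)) (Icc 0 2) := by
  refine strictAntiOn_levelFun ha fun x hx => Real.sin_pos_of_pos_of_lt_pi ?_ ?_
  · have := mul_pos pi_pos hx.1; linarith
  · nlinarith [pi_pos, hx.2]

lemma strictMonoOn_levelFun_half {a : ℝ} (ha : 0 < a) :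
    StrictMonoOn (levelFun a (1 / 2)) (Icc 2 4) := by
  refine strictMonoOn_levelFun ha fun x hx => ?_
  rw [← Real.sin_sub_two_pi]
  apply Real.sin_neg_of_neg_of_neg_pi_lt
  · nlinarith [pi_pos, hx.2]
  · nlinarith [pi_pos, hx.1]

lemma strictMonoOn_levelFun_three_halves {a : ℝ} (ha : 0 < a) :
    StrictMonoOn (levelFun a (3 / 2)) (Icc (10 / 3) 4) := by
  refine strictMonoOn_levelFun ha fun x hx => ?_
  rw [← Real.sin_sub_nat_mul_two_pi _ 3]
  push_cast
  apply Real.sin_neg_of_neg_of_neg_pi_lt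
  · nlinarith [pi_pos, hx.2]
  · nlinarith [pi_pos, hx.1]

lemma strictAntiOn_levelFun_three_halves {a : ℝ} (ha : 0 < a) :
    StrictAntiOn (levelFun a (3 / 2)) (Icc 4 (14 / 3)) := by
  refine strictAntiOn_levelFun ha fun x hx => ?_
  rw [← Real.sin_sub_nat_mul_two_pi _ 3]
  push_cast
  apply Real.sin_pos_of_pos_of_lt_pi
  · nlinarith [pi_pos, hx.1]
  · nlinarith [pi_pos, hx.2]

/-- In a valley, the level of a point on the left slope is attained on the right slope, and the
function stays below that level in between. -/
lemma exists_return_of_valley {f : ℝ → ℝ} (hf : Continuous f) {p m q x : ℝ} (hmq : m ≤ q)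
    (hanti : StrictAntiOn f (Icc p m)) (hmono : StrictMonoOn f (Icc m q))
    (hpx : p ≤ x) (hxm : x < m) (hxq : f x < f q) :
    ∃ v ∈ Ioo m q, f v = f x ∧ ∀ s ∈ Ioo x v, f s < f x := by
  have hm : f m < f x := hanti ⟨hpx, hxm.le⟩ ⟨hpx.trans hxm.le, le_rfl⟩ hxm
  obtain ⟨v, hv, hvx⟩ := intermediate_value_Ioo hmq hf.continuousOn ⟨hm, hxq⟩
  refine ⟨v, hv, hvx, fun s hs => ?_⟩
  rcases le_total s m with h | h
  · exact hanti ⟨hpx, hxm.le⟩ ⟨hpx.trans hs.1.le, h⟩ hs.1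
  · rw [← hvx]
    exact hmono ⟨h, hs.2.le.trans hv.2.le⟩ ⟨hv.1.le, hv.2.le⟩ hs.2

lemma isLeast_return {f : ℝ → ℝ} {x v : ℝ} (hxv : x < v) (hv : f v = f x)
    (hne : ∀ s ∈ Ioo x v, f s ≠ f x) : IsLeast {s | x < s ∧ f s = f x} v :=
  ⟨⟨hxv, hv⟩, fun s hs => by
    by_contra! h
    exact hne s ⟨hs.1, h⟩ hs.2⟩

lemma levelFun_half_zero_lt_four {a : ℝ} (ha : 0 < a) :
    levelFun a (1 / 2) 0 < levelFun a (1 / 2) 4 := by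
  have h : (1 / 2 * π * 4 : ℝ) = 2 * π := by ring
  have h1 : 1 < Real.exp (a * 4) := Real.one_lt_exp_iff.2 (by positivity)
  unfold levelFun
  rw [h]
  simp
  nlinarith [pi_pos]

lemma levelFun_half_lt_reflect {a x : ℝ} (ha : 0 < a) (hx : x ∈ Ioo (0 : ℝ) (2 / 3)) :
    levelFun a (1 / 2) x < levelFun a (1 / 2) (4 - x) := by
  have h : 1 / 2 * π * (4 - x) = 2 * π - 1 / 2 * π * x := by ring
  have hs : 0 < Real.sin (1 / 2 * π * x) := by
    apply Real.sin_pos_of_pos_of_lt_pi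
    · have := mul_pos pi_pos hx.1; linarith
    · nlinarith [pi_pos, hx.2]
  have hc : 0 < Real.cos (1 / 2 * π * x) := by
    apply Real.cos_pos_of_mem_Ioo
    constructor
    · nlinarith [mul_pos pi_pos hx.1, pi_pos]
    · nlinarith [pi_pos, hx.2]
  have he : Real.exp (a * x) < Real.exp (a * (4 - x)) := by
    apply Real.exp_lt_exp.2
    nlinarith [hx.2]
  unfold levelFun
  rw [h, Real.cos_two_pi_sub, Real.sin_two_pi_sub]
  have h1 : 0 < 1 / 2 * π * Real.cos (1 / 2 * π * x) := by positivity
  have h2 : 0 < a * Real.sin (1 / 2 * π * x) := by positivity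
  nlinarith [Real.exp_pos (a * x), mul_pos (Real.exp_pos (a * x)) h2,
    mul_pos (Real.exp_pos (a * (4 - x))) h2, mul_lt_mul_of_pos_right he h1]

lemma levelFun_three_halves_add_four (a x : ℝ) :
    levelFun a (3 / 2) (x + 4) = Real.exp (a * 4) * levelFun a (3 / 2) x := by
  have h : 3 / 2 * π * (x + 4) = 3 / 2 * π * x + (3 : ℕ) * (2 * π) := by push_cast; ring
  unfold levelFun
  rw [h, Real.cos_add_nat_mul_two_pi, Real.sin_add_nat_mul_two_pi, mul_add, Real.exp_add]
  ring

lemma levelFun_three_halves_trough_lt {a : ℝ} (ha : 0 < a) :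
    levelFun a (3 / 2) (14 / 3) < levelFun a (3 / 2) (10 / 3) := by
  have h1 : 3 / 2 * π * (14 / 3) = π + (3 : ℕ) * (2 * π) := by push_cast; ring
  have h2 : 3 / 2 * π * (10 / 3) = π + (2 : ℕ) * (2 * π) := by push_cast; ring
  have he : Real.exp (a * (10 / 3)) < Real.exp (a * (14 / 3)) := by
    apply Real.exp_lt_exp.2
    nlinarith
  unfold levelFun
  rw [h1, h2, Real.cos_add_nat_mul_two_pi, Real.sin_add_nat_mul_two_pi,
    Real.cos_add_nat_mul_two_pi, Real.sin_add_nat_mul_two_pi]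
  simp
  nlinarith [pi_pos]

lemma Pm_spec {a x : ℝ} (ha : 0 < a) (hx0 : 0 ≤ x) (hx2 : x < 2) :
    IsLeast {s : ℝ | x < s ∧ Ysol a (1 / 2) x s = 0} (Pm a x) ∧ Pm a x ∈ Ioo (2 : ℝ) 4 ∧
      levelFun a (1 / 2) (Pm a x) = levelFun a (1 / 2) x ∧
      ∀ s ∈ Ioo x (Pm a x), levelFun a (1 / 2) s < levelFun a (1 / 2) x := by
  have hle : levelFun a (1 / 2) x ≤ levelFun a (1 / 2) 0 :=
    (strictAntiOn_levelFun_half ha).antitoneOn ⟨le_rfl, by norm_num⟩ ⟨hx0, hx2.le⟩ hx0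
  obtain ⟨v, hv, hvx, hlt⟩ := exists_return_of_valley (continuous_levelFun a (1 / 2))
    (by norm_num) (strictAntiOn_levelFun_half ha) (strictMonoOn_levelFun_half ha) hx0 hx2
    (hle.trans_lt (levelFun_half_zero_lt_four ha))
  have hleast : IsLeast {s : ℝ | x < s ∧ Ysol a (1 / 2) x s = 0} v := by
    simp only [Ysol_eq_zero_iff ha]
    exact isLeast_return (hx2.trans hv.1) hvx fun s hs => (hlt s hs).ne
  have : Pm a x = v := hleast.csInf_eq
  rw [this]
  exact ⟨hleast, hv, hvx, hlt⟩

lemma Pp_spec {a y : ℝ} (ha : 0 < a) (hy : y ∈ Ico (10 / 3 : ℝ) 4) :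
    IsLeast {s : ℝ | y < s ∧ Ysol a (3 / 2) y s = 0} (Pp a y) ∧ Pp a y ∈ Ioo (4 : ℝ) (14 / 3) ∧
      levelFun a (3 / 2) (Pp a y) = levelFun a (3 / 2) y ∧
      ∀ s ∈ Ioo y (Pp a y), levelFun a (3 / 2) y < levelFun a (3 / 2) s := by
  have hle : levelFun a (3 / 2) (10 / 3) ≤ levelFun a (3 / 2) y :=
    (strictMonoOn_levelFun_three_halves ha).monotoneOn ⟨le_rfl, by norm_num⟩ ⟨hy.1, hy.2.le⟩ hy.1
  obtain ⟨v, hv, hvx, hlt⟩ := exists_return_of_valley (continuous_levelFun a (3 / 2)).neg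
    (by norm_num) (strictMonoOn_levelFun_three_halves ha).neg
    (strictAntiOn_levelFun_three_halves ha).neg hy.1 hy.2
    (neg_lt_neg ((levelFun_three_halves_trough_lt ha).trans_le hle))
  simp only [Pi.neg_apply, neg_inj, neg_lt_neg_iff] at hvx hlt
  have hleast : IsLeast {s : ℝ | y < s ∧ Ysol a (3 / 2) y s = 0} v := by
    simp only [Ysol_eq_zero_iff ha]
    exact isLeast_return (hy.2.trans hv.1) hvx fun s hs => (hlt s hs).ne'
  have : Pp a y = v := hleast.csInf_eq
  rw [this]
  exact ⟨hleast, hv, hvx, hlt⟩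

/-- A selection of preimages under an injective continuous function on a compact set is
continuous. -/
lemma ContinuousOn.of_comp_injOn {f g : ℝ → ℝ} {s t : Set ℝ} (ht : IsCompact t)
    (hf : ContinuousOn f t) (hinj : InjOn f t) (hg : MapsTo g s t)
    (hfg : ContinuousOn (fun x => f (g x)) s) : ContinuousOn g s := by
  have : CompactSpace t := isCompact_iff_compactSpace.1 ht
  have hemb : Topology.IsClosedEmbedding (t.domRestrict f) :=
    (continuousOn_iff_continuous_domRestrict.1 hf).isClosedEmbedding (injOn_iff_injective.1 hinj)
  have h : Continuous (hg.restrict g s t) :=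
    hemb.continuous_iff.2 (continuousOn_iff_continuous_domRestrict.1 hfg)
  exact continuousOn_iff_continuous_domRestrict.2 (continuous_subtype_val.comp h)

lemma continuousOn_Pm {a : ℝ} (ha : 0 < a) : ContinuousOn (Pm a) (Ico 0 2) := by
  refine ContinuousOn.of_comp_injOn isCompact_Icc (continuous_levelFun a (1 / 2)).continuousOn
    (strictMonoOn_levelFun_half ha).injOn (fun x hx => ?_) ?_
  · exact Ioo_subset_Icc_self (Pm_spec ha hx.1 hx.2).2.1
  · exact (continuous_levelFun a (1 / 2)).continuousOn.congr
      fun x hx => (Pm_spec ha hx.1 hx.2).2.2.1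

lemma exists_levelFun_slope_ratio {a p q : ℝ} (hpq : p < q)
    (hs : ∀ x ∈ Ioo p q, Real.sin (1 / 2 * π * x) ≠ 0) :
    ∃ c ∈ Ioo p q, (levelFun a (3 / 2) q - levelFun a (3 / 2) p) * ((1 / 2) ^ 2 * π ^ 2 + a ^ 2)
      = (levelFun a (1 / 2) q - levelFun a (1 / 2) p) * ((3 / 2) ^ 2 * π ^ 2 + a ^ 2)
        * (3 - 4 * Real.sin (1 / 2 * π * c) ^ 2) := by
  obtain ⟨c, hc, h⟩ := exists_ratio_hasDerivAt_eq_ratio_slope _ _ hpq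
    (continuous_levelFun a (1 / 2)).continuousOn (fun x _ => hasDerivAt_levelFun a (1 / 2) x)
    _ _ (continuous_levelFun a (3 / 2)).continuousOn
    (fun x _ => hasDerivAt_levelFun a (3 / 2) x)
  refine ⟨c, hc, ?_⟩
  have h3 : 3 / 2 * π * c = 3 * (1 / 2 * π * c) := by ring
  rw [h3, Real.sin_three_mul] at h
  have hne : Real.exp (a * c) * Real.sin (1 / 2 * π * c) ≠ 0 :=
    mul_ne_zero (Real.exp_pos _).ne' (hs c hc)
  apply mul_right_cancel₀ hne
  linear_combination -h

/-- The lower return contracts more than the upper return expands, as measured by the upper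
level function. -/
lemma levelFun_three_halves_contract {a c x₁ x₂ v₁ v₂ : ℝ} (ha : 0 < a) (hx₁ : 0 < x₁)
    (hx : x₁ < x₂) (hx₂ : x₂ ≤ c) (hv₂ : 10 / 3 ≤ v₂) (hv : v₂ < v₁)
    (hv₁ : v₁ ≤ 4 - c) (h₁ : levelFun a (1 / 2) v₁ = levelFun a (1 / 2) x₁)
    (h₂ : levelFun a (1 / 2) v₂ = levelFun a (1 / 2) x₂) :
    levelFun a (3 / 2) v₁ - levelFun a (3 / 2) v₂
      < levelFun a (3 / 2) (x₁ + 4) - levelFun a (3 / 2) (x₂ + 4) := by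
  have hreflect : ∀ y : ℝ, Real.sin (1 / 2 * π * y) = -Real.sin (1 / 2 * π * (4 - y)) := by
    intro y
    rw [show 1 / 2 * π * (4 - y) = 2 * π - 1 / 2 * π * y by ring, Real.sin_two_pi_sub, neg_neg]
  have hpos : ∀ y ∈ Ioo (0 : ℝ) 1, 0 < Real.sin (1 / 2 * π * y) := fun y hy =>
    Real.sin_pos_of_pos_of_lt_pi (by have := mul_pos pi_pos hy.1; linarith)
      (by nlinarith [pi_pos, hy.2])
  obtain ⟨η, hη, hηe⟩ := exists_levelFun_slope_ratio (a := a) hx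
    fun y hy => (hpos y ⟨hx₁.trans hy.1, by linarith [hy.2]⟩).ne'
  obtain ⟨ξ, hξ, hξe⟩ := exists_levelFun_slope_ratio (a := a) hv fun y hy => by
    rw [hreflect]
    exact neg_ne_zero.2 (hpos (4 - y) ⟨by linarith [hy.2], by linarith [hy.1]⟩).ne'
  rw [hreflect ξ, neg_sq] at hξe
  have hsη := hpos η ⟨hx₁.trans hη.1, by linarith [hη.2]⟩
  have hsin : Real.sin (1 / 2 * π * η) < Real.sin (1 / 2 * π * (4 - ξ)) := by
    apply Real.sin_lt_sin_of_lt_of_le_pi_div_two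
    · nlinarith [pi_pos, mul_pos pi_pos (hx₁.trans hη.1)]
    · nlinarith [pi_pos, hξ.1]
    · exact mul_lt_mul_of_pos_left (by linarith [hη.2, hξ.2]) (by positivity)
  have hsin34 : Real.sin (1 / 2 * π * η) ^ 2 < 3 / 4 := by
    have hlt : Real.sin (1 / 2 * π * η) < Real.sin (π / 3) := by
      apply Real.sin_lt_sin_of_lt_of_le_pi_div_two
      · nlinarith [pi_pos, mul_pos pi_pos (hx₁.trans hη.1)]
      · linarith [pi_pos]
      · nlinarith [pi_pos, hη.2]
    rw [Real.sin_pi_div_three] at hlt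
    have h3 : Real.sqrt 3 ^ 2 = 3 := Real.sq_sqrt (by norm_num)
    nlinarith
  have hd : 0 < levelFun a (1 / 2) x₁ - levelFun a (1 / 2) x₂ :=
    sub_pos.2 (strictAntiOn_levelFun_half ha ⟨hx₁.le, by linarith⟩
      ⟨(hx₁.trans hx).le, by linarith⟩ hx)
  have hsq : Real.sin (1 / 2 * π * η) ^ 2 < Real.sin (1 / 2 * π * (4 - ξ)) ^ 2 := by
    nlinarith
  have hA : 0 < (1 / 2) ^ 2 * π ^ 2 + a ^ 2 := by positivity
  have hB : 0 < (3 / 2) ^ 2 * π ^ 2 + a ^ 2 := by positivity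
  have hdB := mul_pos hd hB
  have he : 1 < Real.exp (a * 4) := Real.one_lt_exp_iff.2 (by positivity)
  rw [levelFun_three_halves_add_four, levelFun_three_halves_add_four, ← mul_sub]
  have hk : 0 < levelFun a (3 / 2) x₁ - levelFun a (3 / 2) x₂ := by
    refine pos_of_mul_pos_left ?_ hA.le
    linarith [mul_pos hdB (show 0 < 3 - 4 * Real.sin (1 / 2 * π * η) ^ 2 by linarith)]
  have hlt : levelFun a (3 / 2) v₁ - levelFun a (3 / 2) v₂
      < levelFun a (3 / 2) x₁ - levelFun a (3 / 2) x₂ := by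
    refine lt_of_mul_lt_mul_right ?_ hA.le
    rw [h₁, h₂] at hξe
    linarith [mul_pos hdB (sub_pos.2 hsq)]
  exact hlt.trans ((lt_mul_iff_one_lt_left hk).2 he)

lemma hasDerivAt_levelFun_param (ω p q : ℝ) :
    HasDerivAt (fun a => levelFun a ω (p + q * a))
      (p * (ω * π * Real.cos (ω * π * p)) - (ω * π) ^ 2 * q * Real.sin (ω * π * p)
        - Real.sin (ω * π * p)) 0 := by
  have h0 : HasDerivAt (fun a : ℝ => p + q * a) q 0 := by
    simpa using ((hasDerivAt_id (0 : ℝ)).const_mul q).const_add p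
  have h1 : HasDerivAt (fun a : ℝ => a * (p + q * a)) p 0 := by
    exact ((hasDerivAt_id (0 : ℝ)).mul h0).congr_deriv (by simp)
  have h2 := h0.const_mul (ω * π)
  have h := h1.exp.mul ((h2.cos.const_mul (ω * π)).sub ((hasDerivAt_id (0 : ℝ)).mul h2.sin))
  refine h.congr_deriv ?_
  simp
  ring

lemma eventually_pos_of_hasDerivAt {f : ℝ → ℝ} {f' : ℝ} (hf : HasDerivAt f f' 0) (h0 : f 0 = 0)
    (hf' : 0 < f') : ∀ᶠ a in nhdsWithin 0 (Ioi 0), 0 < f a := by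
  have h := (hasDerivAt_iff_tendsto_slope.1 hf).eventually (lt_mem_nhds hf')
  have hle : nhdsWithin (0 : ℝ) (Ioi 0) ≤ nhdsWithin 0 {0}ᶜ :=
    nhdsWithin_mono _ fun x hx => ne_of_gt hx
  filter_upwards [hle h, self_mem_nhdsWithin] with a ha ha0
  rw [slope_def_field, h0, sub_zero, sub_zero] at ha
  exact (div_pos_iff_of_pos_right ha0).1 ha

lemma eventually_levelFun_half_lt :
    ∀ᶠ a in nhdsWithin (0 : ℝ) (Ioi 0),
      levelFun a (1 / 2) (10 / 3) < levelFun a (1 / 2) (2 / 3 - 4 * a) := by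
  have h1 : 1 / 2 * π * (2 / 3) = π / 3 := by ring
  have h2 : 1 / 2 * π * (10 / 3) = 2 * π - π / 3 := by ring
  have h := (hasDerivAt_levelFun_param (1 / 2) (2 / 3) (-4)).sub
    (hasDerivAt_levelFun_param (1 / 2) (10 / 3) 0)
  rw [h1, h2, Real.cos_two_pi_sub, Real.sin_two_pi_sub, Real.cos_pi_div_three,
    Real.sin_pi_div_three] at h
  have hpos := eventually_pos_of_hasDerivAt h ?_ ?_
  · filter_upwards [hpos] with a ha
    simp only [Pi.sub_apply, zero_mul, add_zero, sub_pos] at ha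
    convert ha using 2
    ring
  · simp only [Pi.sub_apply, levelFun, mul_zero, add_zero, h1, h2, Real.cos_two_pi_sub]
    simp
  · have h3 : 1.7 < Real.sqrt 3 := Real.lt_sqrt_of_sq_lt (by norm_num)
    nlinarith [Real.pi_gt_three, Real.pi_lt_four,
      mul_pos (sub_pos.2 h3) (show 0 < π ^ 2 - 2 by nlinarith [Real.pi_gt_three])]

lemma eventually_levelFun_three_halves_lt :
    ∀ᶠ a in nhdsWithin (0 : ℝ) (Ioi 0),
      levelFun a (3 / 2) (2 / 3 - 4 * a + 4) < levelFun a (3 / 2) (10 / 3) := by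
  have h1 : 3 / 2 * π * (14 / 3) = π + (3 : ℕ) * (2 * π) := by push_cast; ring
  have h2 : 3 / 2 * π * (10 / 3) = π + (2 : ℕ) * (2 * π) := by push_cast; ring
  have h := (hasDerivAt_levelFun_param (3 / 2) (10 / 3) 0).sub
    (hasDerivAt_levelFun_param (3 / 2) (14 / 3) (-4))
  rw [h1, h2, Real.cos_add_nat_mul_two_pi, Real.sin_add_nat_mul_two_pi,
    Real.cos_add_nat_mul_two_pi, Real.sin_add_nat_mul_two_pi, Real.cos_pi, Real.sin_pi] at h
  have hpos := eventually_pos_of_hasDerivAt h ?_ ?_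
  · filter_upwards [hpos] with a ha
    simp only [Pi.sub_apply, zero_mul, add_zero, sub_pos] at ha
    convert ha using 2
    ring
  · simp only [Pi.sub_apply, levelFun, mul_zero, add_zero, h1, h2, Real.cos_add_nat_mul_two_pi]
    simp
  · nlinarith [Real.pi_pos]

/-- Gluing two continuous arcs that vanish at their ends gives a continuous periodic function. -/
lemma exists_periodic_glue {f g : ℝ → ℝ} (hf : Continuous f) (hg : Continuous g) {p T v : ℝ}
    (hT : 0 < T) (hv : v ∈ Ioo p (p + T)) (hfg : f v = g v) (hends : f p = g (p + T)) :
    ∃ y : ℝ → ℝ, Continuous y ∧ (∀ x, y (x + T) = y x) ∧ (∀ x ∈ Icc p v, y x = f x) ∧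
      ∀ x ∈ Icc v (p + T), y x = g x := by
  have : Fact (0 < T) := ⟨hT⟩
  set F : ℝ → ℝ := fun x => if x ≤ v then f x else g x
  have hFc : Continuous F := hf.if_le hg continuous_id continuous_const fun x hx => by
    rw [show x = v from hx, hfg]
  have hFp : F p = f p := if_pos hv.1.le
  have hFT : F (p + T) = g (p + T) := if_neg hv.2.not_ge
  have hcont : Continuous (AddCircle.liftIco T p F) :=
    AddCircle.liftIco_continuous (by rw [hFp, hFT, hends]) hFc.continuousOn
  have hval : ∀ x ∈ Ico p (p + T), AddCircle.liftIco T p F (x : AddCircle T) = F x :=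
    fun x hx => AddCircle.liftIco_coe_apply hx
  refine ⟨fun x => AddCircle.liftIco T p F (x : AddCircle T),
    hcont.comp (AddCircle.continuous_mk' T), fun x => ?_, fun x hx => ?_, fun x hx => ?_⟩
  · simp only [AddCircle.coe_add_period]
  · simp only [hval x ⟨hx.1, hx.2.trans_lt hv.2⟩]
    exact if_pos hx.2
  · rcases hx.2.lt_or_eq with h | h
    · simp only [hval x ⟨hv.1.le.trans hx.1, h⟩]
      rcases hx.1.lt_or_eq with h' | h'
      · exact if_neg h'.not_ge
      · rw [← h', ← hfg]
        exact if_pos le_rfl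
    · rw [h]
      simp only [AddCircle.coe_add_period]
      rw [hval p ⟨le_rfl, by linarith⟩, hFp, hends]

lemma continuous_Ysol (a ω xi : ℝ) : Continuous (Ysol a ω xi) := by
  unfold Ysol
  fun_prop

lemma lt_Pm {a x t : ℝ} (ha : 0 < a) (hx : x ∈ Ico (0 : ℝ) 2) (ht : t ∈ Icc (2 : ℝ) 4)
    (h : levelFun a (1 / 2) t < levelFun a (1 / 2) x) : t < Pm a x := by
  obtain ⟨-, hv, hvx, -⟩ := Pm_spec ha hx.1 hx.2
  rw [← hvx] at h
  exact ((strictMonoOn_levelFun_half ha).lt_iff_lt ht (Ioo_subset_Icc_self hv)).1 h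

lemma Pm_lt {a x t : ℝ} (ha : 0 < a) (hx : x ∈ Ico (0 : ℝ) 2) (ht : t ∈ Icc (2 : ℝ) 4)
    (h : levelFun a (1 / 2) x < levelFun a (1 / 2) t) : Pm a x < t := by
  obtain ⟨-, hv, hvx, -⟩ := Pm_spec ha hx.1 hx.2
  rw [← hvx] at h
  exact ((strictMonoOn_levelFun_half ha).lt_iff_lt (Ioo_subset_Icc_self hv) ht).1 h

lemma Pm_lt_Pm {a x y : ℝ} (ha : 0 < a) (hx : 0 ≤ x) (hxy : x < y) (hy : y < 2) :
    Pm a y < Pm a x := by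
  obtain ⟨-, hv, hvx, -⟩ := Pm_spec ha hx (hxy.trans hy)
  refine Pm_lt ha ⟨hx.trans hxy.le, hy⟩ (Ioo_subset_Icc_self hv) ?_
  rw [hvx]
  exact strictAntiOn_levelFun_half ha ⟨hx, (hxy.trans hy).le⟩ ⟨hx.trans hxy.le, hy.le⟩ hxy

lemma Pp_lt {a y t : ℝ} (ha : 0 < a) (hy : y ∈ Ico (10 / 3 : ℝ) 4) (ht : t ∈ Icc (4 : ℝ) (14 / 3))
    (h : levelFun a (3 / 2) t < levelFun a (3 / 2) y) : Pp a y < t := by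
  obtain ⟨-, hz, hzy, -⟩ := Pp_spec ha hy
  rw [← hzy] at h
  exact ((strictAntiOn_levelFun_three_halves ha).lt_iff_gt ht (Ioo_subset_Icc_self hz)).1 h

lemma lt_Pp {a y t : ℝ} (ha : 0 < a) (hy : y ∈ Ico (10 / 3 : ℝ) 4) (ht : t ∈ Icc (4 : ℝ) (14 / 3))
    (h : levelFun a (3 / 2) y < levelFun a (3 / 2) t) : t < Pp a y := by
  obtain ⟨-, hz, hzy, -⟩ := Pp_spec ha hy
  rw [← hzy] at h
  exact ((strictAntiOn_levelFun_three_halves ha).lt_iff_gt (Ioo_subset_Icc_self hz) ht).1 h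

lemma exists_fixed_level {a u : ℝ} (ha : 0 < a) (hu : u ∈ Ioo (0 : ℝ) (2 / 3))
    (hm : 10 / 3 < Pm a u)
    (hp : levelFun a (3 / 2) (u + 4) < levelFun a (3 / 2) (10 / 3)) :
    ∃ x ∈ Ioo 0 u, levelFun a (3 / 2) (x + 4) = levelFun a (3 / 2) (Pm a x) := by
  have hu2 : u < 2 := by linarith [hu.2]
  have hcont : ContinuousOn
      (fun x => levelFun a (3 / 2) (x + 4) - levelFun a (3 / 2) (Pm a x)) (Icc 0 u) := by
    refine ContinuousOn.sub ?_ ?_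
    · exact ((continuous_levelFun a (3 / 2)).comp (continuous_id.add continuous_const)).continuousOn
    · exact (continuous_levelFun a (3 / 2)).comp_continuousOn
        ((continuousOn_Pm ha).mono fun x hx => ⟨hx.1, hx.2.trans_lt hu2⟩)
  have hmono := strictMonoOn_levelFun_three_halves ha
  have h0 : levelFun a (3 / 2) (Pm a 0) < levelFun a (3 / 2) (0 + 4) := by
    have h4 := (Pm_spec ha le_rfl (by norm_num : (0 : ℝ) < 2)).2.1.2
    rw [zero_add]
    exact hmono ⟨(hm.trans (Pm_lt_Pm ha le_rfl hu.1 hu2)).le, h4.le⟩ ⟨by norm_num, le_rfl⟩ h4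
  have h1 : levelFun a (3 / 2) (u + 4) < levelFun a (3 / 2) (Pm a u) :=
    hp.trans (hmono ⟨le_rfl, by norm_num⟩ ⟨hm.le, (Pm_spec ha hu.1.le hu2).2.1.2.le⟩ hm)
  obtain ⟨x, hx, hx0⟩ := intermediate_value_Ioo' hu.1.le hcont ⟨sub_neg.2 h1, sub_pos.2 h0⟩
  exact ⟨x, hx, sub_eq_zero.1 hx0⟩

/-- for all sufficiently small `a > 0` the linear switching
system has a non-sliding, locally asymptotically stable 4-periodic solution:
there is a crossing point `x* ∈ (0, 2/3)` which is a fixed point of the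
period-4 return map `x ↦ P₊ᵃ(P₋ᵃ(x)) − 4`, locally attracting; the solution
through it stays negative in the lower arc and positive in the upper arc, and
the two arcs concatenate into a continuous 4-periodic function on ℝ. -/
theorem nonsliding_periodic_orbit_small_damping :
    ∃ al : ℝ, 0 < al ∧ ∀ a ∈ Set.Ioo (0 : ℝ) al,
      ∃ xs ∈ Set.Ioo (0 : ℝ) (2 / 3), ∃ μ : ℝ, 0 < μ ∧
        (∀ x : ℝ, |x - xs| < μ →
          IsLeast {s : ℝ | x < s ∧ Ysol a (1 / 2) x s = 0} (Pm a x) ∧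
          IsLeast {s : ℝ | Pm a x < s ∧ Ysol a (3 / 2) (Pm a x) s = 0} (Pp a (Pm a x))) ∧
        Pp a (Pm a xs) = xs + 4 ∧
        (∀ x : ℝ, 0 < |x - xs| → |x - xs| < μ →
          |Pp a (Pm a x) - 4 - xs| < |x - xs|) ∧
        (∀ x ∈ Set.Ioo xs (Pm a xs), Ysol a (1 / 2) xs x < 0) ∧
        (∀ x ∈ Set.Ioo (Pm a xs) (xs + 4), 0 < Ysol a (3 / 2) (Pm a xs) x) ∧
        ∃ yp : ℝ → ℝ, Continuous yp ∧ (∀ x : ℝ, yp (x + 4) = yp x) ∧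
          (∀ x ∈ Set.Icc xs (Pm a xs), yp x = Ysol a (1 / 2) xs x) ∧
          (∀ x ∈ Set.Icc (Pm a xs) (xs + 4), yp x = Ysol a (3 / 2) (Pm a xs) x) := by
  have hev := eventually_levelFun_half_lt.and (eventually_levelFun_three_halves_lt.and
    (Ioo_mem_nhdsGT (show (0 : ℝ) < 1 / 6 by norm_num)))
  obtain ⟨al, hal, hsub⟩ := mem_nhdsGT_iff_exists_Ioo_subset.1 hev
  refine ⟨al, hal, fun a haI => ?_⟩
  obtain ⟨hA, hB, ha, ha6⟩ := hsub haI
  set u : ℝ := 2 / 3 - 4 * a with hu_def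
  have hu : u ∈ Ioo (0 : ℝ) (2 / 3) := ⟨by linarith, by linarith⟩
  have hPm_mem : ∀ x ∈ Ioo 0 u, Pm a x ∈ Ico (10 / 3 : ℝ) 4 := fun x hx =>
    have hx2 : x < 2 := by linarith [hx.2, hu.2]
    ⟨(lt_Pm ha ⟨hx.1.le, hx2⟩ (by norm_num) (hA.trans (strictAntiOn_levelFun_half ha
      ⟨hx.1.le, hx2.le⟩ ⟨hu.1.le, by linarith [hu.2]⟩ hx.2))).le,
      (Pm_spec ha hx.1.le hx2).2.1.2⟩
  obtain ⟨xs, hxs, hfix⟩ := exists_fixed_level ha hu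
    (lt_Pm ha ⟨hu.1.le, by linarith [hu.2]⟩ (by norm_num) hA) hB
  have hxs' : xs ∈ Ioo (0 : ℝ) (2 / 3) := ⟨hxs.1, hxs.2.trans hu.2⟩
  have hxs2 : xs < 2 := by linarith [hxs'.2]
  obtain ⟨-, hv, hvx, hvlt⟩ := Pm_spec ha hxs.1.le hxs2
  obtain ⟨-, hz, hzx, hzlt⟩ := Pp_spec ha (hPm_mem xs hxs)
  have hPfix : Pp a (Pm a xs) = xs + 4 :=
    (strictAntiOn_levelFun_three_halves ha).injOn (Ioo_subset_Icc_self hz)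
      ⟨by linarith [hxs.1], by linarith [hxs'.2]⟩ (hzx.trans hfix.symm)
  have hvw : Pm a xs < 4 - xs :=
    Pm_lt ha ⟨hxs.1.le, hxs2⟩ ⟨by linarith, by linarith [hxs.1]⟩ (levelFun_half_lt_reflect ha hxs')
  obtain ⟨c, hxc, hcv⟩ : ∃ c, xs < c ∧ c < 4 - Pm a xs := exists_between (by linarith)
  have hc : c < 2 / 3 := by linarith [(hPm_mem xs hxs).1]
  have hHc : levelFun a (1 / 2) xs < levelFun a (1 / 2) (4 - c) := by
    rw [← hvx]
    exact strictMonoOn_levelFun_half ha (Ioo_subset_Icc_self hv)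
      ⟨by linarith, by linarith [hxs.1]⟩ (by linarith)
  have hnear : ∀ᶠ x in nhds xs, x ∈ Ioo 0 u ∧ x < c ∧
      levelFun a (1 / 2) x < levelFun a (1 / 2) (4 - c) :=
    Filter.Eventually.and (Ioo_mem_nhds hxs.1 hxs.2) ((gt_mem_nhds hxc).and
      ((continuous_levelFun a (1 / 2)).continuousAt.eventually (gt_mem_nhds hHc)))
  obtain ⟨μ, hμ, hball⟩ := Metric.eventually_nhds_iff.1 hnear
  refine ⟨xs, hxs', μ, hμ, fun x hx => ?_, hPfix, fun x hx0 hx => ?_, fun x hx => ?_,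
    fun x hx => ?_, ?_⟩
  · obtain ⟨hxu, -⟩ := hball (show dist x xs < μ from hx)
    exact ⟨(Pm_spec ha hxu.1.le (by linarith [hxu.2, hu.2])).1, (Pp_spec ha (hPm_mem x hxu)).1⟩
  · obtain ⟨hxu, hxc', hxH⟩ := hball (show dist x xs < μ from hx)
    have hx2 : x < 2 := by linarith [hxu.2, hu.2]
    have hvx' := (Pm_spec ha hxu.1.le hx2).2.2.1
    have hmem := hPm_mem x hxu
    have hmem' := hPm_mem xs hxs
    have hx4 : x + 4 ∈ Icc (4 : ℝ) (14 / 3) := ⟨by linarith [hxu.1], by linarith [hxu.2, hu.2]⟩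
    have hxs4 : xs + 4 ∈ Icc (4 : ℝ) (14 / 3) := ⟨by linarith [hxs.1], by linarith [hxs'.2]⟩
    have hKmono := strictMonoOn_levelFun_three_halves ha
    rcases lt_or_gt_of_ne (sub_ne_zero.1 (abs_pos.1 hx0)) with h | h
    · have hvv := Pm_lt_Pm ha hxu.1.le h hxs2
      have hvc : Pm a x ≤ 4 - c :=
        (Pm_lt ha ⟨hxu.1.le, hx2⟩ ⟨by linarith, by linarith [hxs.1]⟩ hxH).le
      have hcon := levelFun_three_halves_contract ha hxu.1 h hxc.le hmem'.1 hvv hvc hvx' hvx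
      have h1 : x + 4 < Pp a (Pm a x) := lt_Pp ha hmem hx4 (by linarith)
      have h2 : Pp a (Pm a x) < xs + 4 := Pp_lt ha hmem hxs4 (by
        rw [hfix]
        exact hKmono ⟨hmem'.1, hmem'.2.le⟩ ⟨hmem.1, hmem.2.le⟩ hvv)
      rw [abs_of_neg (by linarith), abs_of_neg (by linarith)]
      linarith
    · have hvv := Pm_lt_Pm ha hxs.1.le h hx2
      have hcon := levelFun_three_halves_contract ha hxs.1 h hxc'.le hmem.1 hvv
        (by linarith) hvx hvx'
      have h1 : Pp a (Pm a x) < x + 4 := Pp_lt ha hmem hx4 (by linarith)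
      have h2 : xs + 4 < Pp a (Pm a x) := lt_Pp ha hmem hxs4 (by
        rw [hfix]
        exact hKmono ⟨hmem.1, hmem.2.le⟩ ⟨hmem'.1, hmem'.2.le⟩ hvv)
      rw [abs_of_pos (by linarith), abs_of_pos (by linarith)]
      linarith
  · exact (Ysol_neg_iff ha _ _ _).2 (hvlt x hx)
  · rw [← hPfix] at hx
    exact (Ysol_pos_iff ha _ _ _).2 (hzlt x hx)
  · refine exists_periodic_glue (continuous_Ysol a (1 / 2) xs) (continuous_Ysol a (3 / 2) (Pm a xs))
      (by norm_num) ⟨hxs2.trans hv.1, by linarith [hv.2, hxs.1]⟩ ?_ ?_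
    · rw [(Ysol_eq_zero_iff ha _ _ _).2 hvx, (Ysol_eq_zero_iff ha _ _ _).2 rfl]
    · rw [(Ysol_eq_zero_iff ha _ _ _).2 rfl, (Ysol_eq_zero_iff ha _ _ _).2 hfix]
end

section
/- For every a > 0 the first-return point P_+^a(10/3) := min{x > 10/3 : Y_{a,3/2,10/3}(x) = 0} exists and lies in the open interval (4, 14/3). Moreover P_+^a(10/3) → 4⁺ as a → +∞; that is, for every δ > 0 there exists A > 0 such that P_+^a(10/3) ∈ (4, 4 + δ) for all a > A. -/
open Real Set

/-- Up to a positive factor, the solution issuing from `10 / 3` with frequency `3 / 2`,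
in terms of the elapsed time. -/
noncomputable def scaledSol (a t : ℝ) : ℝ :=
  Real.exp (a * t) * (a * Real.sin (3 / 2 * π * t) - 3 / 2 * π * Real.cos (3 / 2 * π * t))
    + 3 / 2 * π

lemma Ysol_eq_scaledSol (a x : ℝ) :
    Ysol a (3 / 2) (10 / 3) x =
      Real.exp (-a * (x - 10 / 3)) * scaledSol a (x - 10 / 3) / ((3 / 2) ^ 2 * π ^ 2 + a ^ 2) := by
  have hx : 3 / 2 * π * x = 3 / 2 * π * (x - 10 / 3) + π + (2 : ℕ) * (2 * π) := by
    push_cast; ring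
  have hi : 3 / 2 * π * (10 / 3) = π + (2 : ℕ) * (2 * π) := by push_cast; ring
  have hexp : Real.exp (-a * (x - 10 / 3)) * Real.exp (a * (x - 10 / 3)) = 1 := by
    rw [← Real.exp_add]; simp
  unfold Ysol scaledSol
  rw [hx, hi, Real.cos_add_nat_mul_two_pi, Real.sin_add_nat_mul_two_pi,
    Real.cos_add_nat_mul_two_pi, Real.sin_add_nat_mul_two_pi, Real.cos_add_pi, Real.sin_add_pi,
    Real.cos_pi, Real.sin_pi]
  congr 1
  linear_combination (-(a * Real.sin (3 / 2 * π * (x - 10 / 3))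
    - 3 / 2 * π * Real.cos (3 / 2 * π * (x - 10 / 3)))) * hexp

lemma Ysol_eq_zero_iff_s5 (a x : ℝ) :
    Ysol a (3 / 2) (10 / 3) x = 0 ↔ scaledSol a (x - 10 / 3) = 0 := by
  have hden : (3 / 2 : ℝ) ^ 2 * π ^ 2 + a ^ 2 ≠ 0 := by positivity
  simp [Ysol_eq_scaledSol, hden, Real.exp_ne_zero]

lemma hasDerivAt_scaledSol (a t : ℝ) :
    HasDerivAt (scaledSol a)
      (Real.exp (a * t) * ((a ^ 2 + (3 / 2 * π) ^ 2) * Real.sin (3 / 2 * π * t))) t := by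
  have hlin : HasDerivAt (fun t : ℝ => 3 / 2 * π * t) (3 / 2 * π) t := by
    simpa using (hasDerivAt_id t).const_mul (3 / 2 * π)
  have hexp : HasDerivAt (fun t : ℝ => Real.exp (a * t)) (Real.exp (a * t) * a) t := by
    simpa using ((hasDerivAt_id t).const_mul a).exp
  refine ((hexp.mul ((hlin.sin.const_mul a).sub (hlin.cos.const_mul (3 / 2 * π)))).add_const
    (3 / 2 * π)).congr_deriv ?_
  simp only [Pi.sub_apply]
  ring

lemma continuous_scaledSol (a : ℝ) : Continuous (scaledSol a) := by
  unfold scaledSol; fun_prop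

lemma scaledSol_pos {a t : ℝ} (ht : 0 < t) (ht' : t ≤ 2 / 3) : 0 < scaledSol a t := by
  have hmono : StrictMonoOn (scaledSol a) (Icc 0 (2 / 3)) := by
    refine strictMonoOn_of_deriv_pos (convex_Icc _ _) (continuous_scaledSol a).continuousOn ?_
    intro s hs
    rw [interior_Icc] at hs
    rw [(hasDerivAt_scaledSol a s).deriv]
    have hsin : 0 < Real.sin (3 / 2 * π * s) := by
      apply Real.sin_pos_of_pos_of_lt_pi
      · have := hs.1
        positivity
      · nlinarith [hs.2, Real.pi_pos]
    positivity
  have h := hmono (left_mem_Icc.2 (by norm_num)) ⟨ht.le, ht'⟩ ht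
  simpa [scaledSol] using h

lemma scaledSol_four_thirds_neg {a : ℝ} (ha : 0 < a) : scaledSol a (4 / 3) < 0 := by
  have hangle : 3 / 2 * π * (4 / 3) = 2 * π := by ring
  have hexp : 1 < Real.exp (a * (4 / 3)) := Real.one_lt_exp_iff.2 (by positivity)
  rw [scaledSol, hangle, Real.sin_two_pi, Real.cos_two_pi]
  nlinarith [Real.pi_pos]

lemma scaledSol_neg_of_large {a ε : ℝ} (hε : 0 < ε) (hε' : ε < 2 / 3)
    (ha : 3 * π / Real.sin (3 / 2 * π * ε) < a) : scaledSol a (2 / 3 + ε) < 0 := by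
  have hsin : 0 < Real.sin (3 / 2 * π * ε) :=
    Real.sin_pos_of_pos_of_lt_pi (by positivity) (by nlinarith [Real.pi_pos])
  have ha0 : 0 < a := lt_trans (by positivity) ha
  have hangle : 3 / 2 * π * (2 / 3 + ε) = 3 / 2 * π * ε + π := by ring
  have hexp : 1 < Real.exp (a * (2 / 3 + ε)) := Real.one_lt_exp_iff.2 (by positivity)
  have hprod : 3 * π < a * Real.sin (3 / 2 * π * ε) := (div_lt_iff₀ hsin).1 ha
  have hcos := mul_le_mul_of_nonneg_left (Real.cos_le_one (3 / 2 * π * ε))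
    (by positivity : 0 ≤ 3 / 2 * π)
  rw [scaledSol, hangle, Real.sin_add_pi, Real.cos_add_pi]
  have hfactor : a * -Real.sin (3 / 2 * π * ε) - 3 / 2 * π * -Real.cos (3 / 2 * π * ε)
      < -(3 / 2 * π) := by linarith
  nlinarith [Real.pi_pos]

/-- If the solution has become negative at some `b > 4`, then the first return happens in
`(4, b)`. -/
lemma isLeast_Pp_and_mem_Ioo {a b : ℝ} (hb : 4 < b) (hneg : scaledSol a (b - 10 / 3) < 0) :
    IsLeast {x : ℝ | 10 / 3 < x ∧ Ysol a (3 / 2) (10 / 3) x = 0} (Pp a (10 / 3)) ∧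
      Pp a (10 / 3) ∈ Ioo 4 b := by
  have hcont : Continuous fun x => scaledSol a (x - 10 / 3) :=
    (continuous_scaledSol a).comp (continuous_id.sub continuous_const)
  have hpos : ∀ x : ℝ, 10 / 3 < x → x ≤ 4 → 0 < scaledSol a (x - 10 / 3) := fun x hx hx' =>
    scaledSol_pos (by linarith) (by linarith)
  obtain ⟨z, hz, hz0⟩ := intermediate_value_Icc' hb.le hcont.continuousOn
    ⟨hneg.le, (hpos 4 (by norm_num) le_rfl).le⟩
  have hcompact : IsCompact (Icc 4 b ∩ {x | scaledSol a (x - 10 / 3) = 0}) :=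
    isCompact_Icc.inter_right (isClosed_eq hcont continuous_const)
  obtain ⟨p, ⟨hp, hp0⟩, hmin⟩ := hcompact.exists_isLeast ⟨z, hz, hz0⟩
  have hleast : IsLeast {x : ℝ | 10 / 3 < x ∧ Ysol a (3 / 2) (10 / 3) x = 0} p := by
    refine ⟨⟨by linarith [hp.1], (Ysol_eq_zero_iff_s5 a p).2 hp0⟩, fun x hx => ?_⟩
    have hx0 := (Ysol_eq_zero_iff_s5 a x).1 hx.2
    by_contra! hlt
    rcases le_or_gt x 4 with h4 | h4
    · exact (hpos x hx.1 h4).ne' hx0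
    · exact hlt.not_ge (hmin ⟨⟨h4.le, hlt.le.trans hp.2⟩, hx0⟩)
  have hPp : Pp a (10 / 3) = p := hleast.csInf_eq
  rw [hPp]
  refine ⟨hleast, lt_of_le_of_ne hp.1 ?_, lt_of_le_of_ne hp.2 ?_⟩
  · rintro rfl
    exact (hpos 4 (by norm_num) le_rfl).ne' hp0
  · rintro rfl
    exact hneg.ne hp0

/-- for every `a > 0` the first-return point `P₊ᵃ(10/3)` exists
(as a minimum) and lies in `(4, 14/3)`; moreover `P₊ᵃ(10/3) → 4⁺` as
`a → +∞`. -/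
theorem first_return_from_ten_thirds :
    (∀ a : ℝ, 0 < a →
      IsLeast {x : ℝ | 10 / 3 < x ∧ Ysol a (3 / 2) (10 / 3) x = 0} (Pp a (10 / 3)) ∧
      Pp a (10 / 3) ∈ Set.Ioo (4 : ℝ) (14 / 3)) ∧
    ∀ δ : ℝ, 0 < δ → ∃ A : ℝ, 0 < A ∧ ∀ a : ℝ, A < a →
      Pp a (10 / 3) ∈ Set.Ioo (4 : ℝ) (4 + δ) := by
  refine ⟨fun a ha => isLeast_Pp_and_mem_Ioo (by norm_num) ?_, fun δ hδ => ?_⟩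
  · convert scaledSol_four_thirds_neg ha using 2
    norm_num
  · obtain ⟨ε, hε, hε'⟩ := exists_between (lt_min hδ (by norm_num : (0 : ℝ) < 2 / 3))
    obtain ⟨hεδ, hε'⟩ := lt_min_iff.1 hε'
    have hsin : 0 < Real.sin (3 / 2 * π * ε) :=
      Real.sin_pos_of_pos_of_lt_pi (by positivity) (by nlinarith [Real.pi_pos])
    refine ⟨3 * π / Real.sin (3 / 2 * π * ε), by positivity, fun a ha => ?_⟩
    have hneg : scaledSol a (4 + ε - 10 / 3) < 0 := by
      convert scaledSol_neg_of_large hε hε' ha using 2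
      ring
    exact Ioo_subset_Ioo_right (by linarith) (isLeast_Pp_and_mem_Ioo (by linarith) hneg).2
end

section
/- For every δ > 0 there exists A > 0 such that for all a > A the second return point of the orbit leaving x = 10/3 satisfies P_−^a(P_+^a(10/3)) ∈ (6, 6 + δ); in particular (P_−^a ∘ P_+^a)(10/3) → 6⁺ as a → +∞. -/
open Real Set

/-- A continuous function that vanishes at `l`, increases strictly up to `m` and is negative
at `b` has a first zero after `l`, which lies in `(m, b)`. -/
lemma exists_isLeast_zero_of_strictMonoOn {h : ℝ → ℝ} (hc : Continuous h) {l m b : ℝ}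
    (hlm : l < m) (hmb : m < b) (hl : h l = 0) (hmono : StrictMonoOn h (Set.Icc l m))
    (hb : h b < 0) :
    ∃ p ∈ Set.Ioo m b, IsLeast {x : ℝ | l < x ∧ h x = 0} p := by
  have hpos : ∀ x, l < x → x ≤ m → 0 < h x := fun x hx hxm => by
    rw [← hl]
    exact hmono ⟨le_rfl, hlm.le⟩ ⟨hx.le, hxm⟩ hx
  have hm := hpos m hlm le_rfl
  have hcomp : IsCompact (Set.Icc m b ∩ h ⁻¹' {0}) :=
    isCompact_Icc.inter_right (isClosed_singleton.preimage hc)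
  obtain ⟨z, hz, hz0⟩ := intermediate_value_Icc' hmb.le hc.continuousOn ⟨hb.le, hm.le⟩
  obtain ⟨p, ⟨⟨hmp, hpb⟩, hp0⟩, hpmin⟩ := hcomp.exists_isLeast ⟨z, hz, hz0⟩
  have hp0 : h p = 0 := hp0
  have hmp' : m < p := hmp.lt_of_ne (by rintro rfl; exact hm.ne' hp0)
  have hpb' : p < b := hpb.lt_of_ne (by rintro rfl; exact hb.ne hp0)
  refine ⟨p, ⟨hmp', hpb'⟩, ⟨hlm.trans hmp', hp0⟩, ?_⟩
  rintro x ⟨hlx, hx0⟩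
  by_contra! hxp
  rcases le_total x m with hxm | hmx
  · exact (hpos x hlx hxm).ne' hx0
  · exact absurd (hpmin ⟨⟨hmx, hxp.le.trans hpb⟩, hx0⟩) hxp.not_ge

lemma Ysol_self (a ω xi : ℝ) : Ysol a ω xi xi = 0 := by
  simp [Ysol]

lemma hasDerivAt_exp_mul_Ysol {a : ℝ} (ha : 0 < a) (ω xi x : ℝ) :
    HasDerivAt (fun x => Real.exp (a * x) * Ysol a ω xi x)
      (-(Real.exp (a * x) * Real.sin (ω * π * x))) x := by
  have hD : ω ^ 2 * π ^ 2 + a ^ 2 ≠ 0 := by positivity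
  have hlin : HasDerivAt (fun x => ω * π * x) (ω * π) x := by
    simpa using (hasDerivAt_id x).const_mul (ω * π)
  have he : HasDerivAt (fun x => Real.exp (a * x)) (Real.exp (a * x) * a) x := by
    simpa using ((hasDerivAt_id x).const_mul a).exp
  have he' : HasDerivAt (fun x => Real.exp (-a * (x - xi)))
      (Real.exp (-a * (x - xi)) * (-a)) x := by
    simpa using (((hasDerivAt_id x).sub_const xi).const_mul (-a)).exp
  have key := he.mul ((((hlin.cos.const_mul (ω * π)).sub (hlin.sin.const_mul a)).add
    (he'.mul_const (a * Real.sin (ω * π * xi) - ω * π * Real.cos (ω * π * xi)))).div_const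
    (ω ^ 2 * π ^ 2 + a ^ 2))
  refine key.congr_deriv ?_
  simp only [Pi.add_apply, Pi.sub_apply]
  field_simp
  ring

lemma continuous_exp_mul_Ysol {a : ℝ} (ha : 0 < a) (ω xi : ℝ) :
    Continuous (fun x => Real.exp (a * x) * Ysol a ω xi x) :=
  continuous_iff_continuousAt.2 fun x => (hasDerivAt_exp_mul_Ysol ha ω xi x).continuousAt

/-- First return through the upper half-plane: the forcing is positive on `(l, m)`. -/
lemma exists_isLeast_Ysol_zero_of_sin_neg {a ω l m b : ℝ} (ha : 0 < a) (hlm : l < m)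
    (hmb : m < b) (hsin : ∀ x ∈ Set.Ioo l m, Real.sin (ω * π * x) < 0) (hb : Ysol a ω l b < 0) :
    ∃ p ∈ Set.Ioo m b, IsLeast {x : ℝ | l < x ∧ Ysol a ω l x = 0} p := by
  have hc := continuous_exp_mul_Ysol ha ω l
  have hmono : StrictMonoOn (fun x => Real.exp (a * x) * Ysol a ω l x) (Set.Icc l m) := by
    refine strictMonoOn_of_deriv_pos (convex_Icc l m) hc.continuousOn fun x hx => ?_
    rw [interior_Icc] at hx
    rw [(hasDerivAt_exp_mul_Ysol ha ω l x).deriv]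
    exact neg_pos.2 (mul_neg_of_pos_of_neg (Real.exp_pos _) (hsin x hx))
  simpa [Real.exp_ne_zero] using exists_isLeast_zero_of_strictMonoOn hc hlm hmb
    (by simp [Ysol_self]) hmono (mul_neg_of_pos_of_neg (Real.exp_pos _) hb)

/-- First return through the lower half-plane: the forcing is negative on `(l, m)`. -/
lemma exists_isLeast_Ysol_zero_of_sin_pos {a ω l m b : ℝ} (ha : 0 < a) (hlm : l < m)
    (hmb : m < b) (hsin : ∀ x ∈ Set.Ioo l m, 0 < Real.sin (ω * π * x)) (hb : 0 < Ysol a ω l b) :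
    ∃ p ∈ Set.Ioo m b, IsLeast {x : ℝ | l < x ∧ Ysol a ω l x = 0} p := by
  have hc := (continuous_exp_mul_Ysol ha ω l).neg
  have hmono : StrictMonoOn (fun x => -(Real.exp (a * x) * Ysol a ω l x)) (Set.Icc l m) := by
    refine strictMonoOn_of_deriv_pos (convex_Icc l m) hc.continuousOn fun x hx => ?_
    rw [interior_Icc] at hx
    rw [(hasDerivAt_exp_mul_Ysol ha ω l x).fun_neg.deriv, neg_neg]
    exact mul_pos (Real.exp_pos _) (hsin x hx)
  simpa [Real.exp_ne_zero] using exists_isLeast_zero_of_strictMonoOn hc hlm hmb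
    (by simp [Ysol_self]) hmono (neg_neg_of_pos (mul_pos (Real.exp_pos _) hb))

lemma exists_isLeast_Ysol_zero_ten_thirds {a : ℝ} (ha : 0 < a) :
    ∃ p ∈ Set.Ioo (4 : ℝ) (14 / 3),
      IsLeast {x : ℝ | 10 / 3 < x ∧ Ysol a (3 / 2) (10 / 3) x = 0} p := by
  have hπ := Real.pi_pos
  refine exists_isLeast_Ysol_zero_of_sin_neg ha (by norm_num) (by norm_num) ?_ ?_
  · rintro x ⟨h1, h2⟩
    rw [← Real.sin_sub_int_mul_two_pi _ 3]
    push_cast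
    exact Real.sin_neg_of_neg_of_neg_pi_lt (by nlinarith) (by nlinarith)
  · have e1 : (3 / 2 : ℝ) * π * (14 / 3) = π + (3 : ℕ) * (2 * π) := by push_cast; ring
    have e2 : (3 / 2 : ℝ) * π * (10 / 3) = π + (2 : ℕ) * (2 * π) := by push_cast; ring
    have he : Real.exp (-a * (14 / 3 - 10 / 3)) < 1 := Real.exp_lt_one_iff.2 (by linarith)
    rw [Ysol, e1, e2, Real.cos_add_nat_mul_two_pi, Real.sin_add_nat_mul_two_pi,
      Real.cos_add_nat_mul_two_pi, Real.sin_add_nat_mul_two_pi, Real.cos_pi, Real.sin_pi]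
    refine div_neg_of_neg_of_pos ?_ (by positivity)
    nlinarith

lemma Ysol_half_six_add_pos {a p d : ℝ} (ha : 0 < a) (hp : p ∈ Set.Ioo (4 : ℝ) 6) (hd : 0 < d)
    (had : π < a * Real.sin (π / 2 * d)) : 0 < Ysol a (1 / 2) p (6 + d) := by
  obtain ⟨hp4, hp6⟩ := hp
  have hπ := Real.pi_pos
  have e : (1 / 2 : ℝ) * π * (6 + d) = π / 2 * d + π + (1 : ℕ) * (2 * π) := by push_cast; ring
  have hs : 0 ≤ Real.sin (1 / 2 * π * p) := by
    rw [← Real.sin_sub_two_pi]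
    exact Real.sin_nonneg_of_nonneg_of_le_pi (by nlinarith) (by nlinarith)
  have he : Real.exp (-a * (6 + d - p)) ≤ 1 := Real.exp_le_one_iff.2 (by nlinarith)
  have hE := Real.exp_pos (-a * (6 + d - p))
  have hC : -(π / 2) ≤ a * Real.sin (1 / 2 * π * p) - 1 / 2 * π * Real.cos (1 / 2 * π * p) := by
    nlinarith [Real.cos_le_one (1 / 2 * π * p), mul_nonneg ha.le hs]
  rw [Ysol, e, Real.cos_add_nat_mul_two_pi, Real.sin_add_nat_mul_two_pi, Real.cos_add_pi,
    Real.sin_add_pi]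
  refine div_pos ?_ (by positivity)
  nlinarith [Real.cos_le_one (π / 2 * d), mul_le_mul_of_nonneg_left hC hE.le]

/-- the second return point of the orbit leaving `x = 10/3`
tends to `6⁺` as `a → +∞`: for every `δ > 0` there is `A > 0` such that for
all `a > A` both return points are well defined (as minima) and
`P₋ᵃ(P₊ᵃ(10/3)) ∈ (6, 6 + δ)`. -/
theorem second_return_from_ten_thirds :
    ∀ δ : ℝ, 0 < δ → ∃ A : ℝ, 0 < A ∧ ∀ a : ℝ, A < a →
      IsLeast {x : ℝ | 10 / 3 < x ∧ Ysol a (3 / 2) (10 / 3) x = 0} (Pp a (10 / 3)) ∧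
      IsLeast {x : ℝ | Pp a (10 / 3) < x ∧ Ysol a (1 / 2) (Pp a (10 / 3)) x = 0}
        (Pm a (Pp a (10 / 3))) ∧
      Pm a (Pp a (10 / 3)) ∈ Set.Ioo (6 : ℝ) (6 + δ) := by
  intro δ hδ
  have hπ := Real.pi_pos
  obtain ⟨d, hd, hdδ, hd1⟩ : ∃ d : ℝ, 0 < d ∧ d ≤ δ ∧ d ≤ 1 :=
    ⟨min δ 1, by positivity, min_le_left _ _, min_le_right _ _⟩
  have hs : 0 < Real.sin (π / 2 * d) :=
    Real.sin_pos_of_pos_of_lt_pi (by positivity) (by nlinarith)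
  refine ⟨π / Real.sin (π / 2 * d), by positivity, fun a haA => ?_⟩
  have ha : 0 < a := (by positivity : 0 < π / Real.sin (π / 2 * d)).trans haA
  obtain ⟨p, ⟨hp4, hp14⟩, hpl⟩ := exists_isLeast_Ysol_zero_ten_thirds ha
  have hPp : Pp a (10 / 3) = p := hpl.csInf_eq
  have hp6 : p < 6 := by linarith
  obtain ⟨q, ⟨hq6, hqd⟩, hql⟩ := exists_isLeast_Ysol_zero_of_sin_pos (ω := 1 / 2) ha hp6
    (lt_add_of_pos_right 6 hd)
    (fun x hx => by
      rw [← Real.sin_sub_two_pi]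
      exact Real.sin_pos_of_pos_of_lt_pi (by nlinarith [hx.1]) (by nlinarith [hx.2]))
    (Ysol_half_six_add_pos ha ⟨hp4, hp6⟩ hd ((div_lt_iff₀ hs).1 haA))
  have hPm : Pm a p = q := hql.csInf_eq
  rw [hPp, hPm]
  exact ⟨hpl, hql, hq6, by linarith⟩
end

section
/- For every a > 0: (i) for every integer n ≥ 1, the first-return point P_+^a(4n−2) := min{x > 4n−2 : Y_{a,3/2,4n−2}(x) = 0} exists and lies in (4n − 4/3, 4n − 2/3); (ii) for every n ∈ ℕ, the first-return point P_−^a(4n) := min{x > 4n : Y_{a,1/2,4n}(x) = 0} exists and lies in (4n + 2, 4n + 4). -/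
open Real Set

/-- The first-return condition measured from the starting time: up to a nonzero factor, the
solution of `y′ = −a·y − sin(wt)`, `y(0) = 0`, multiplied by the integrating factor `exp (a·t)`. -/
noncomputable def returnFun (a w t : ℝ) : ℝ :=
  Real.exp (a * t) * (w * Real.cos (w * t) - a * Real.sin (w * t)) - w

lemma hasDerivAt_returnFun (a w t : ℝ) :
    HasDerivAt (returnFun a w) (-((a ^ 2 + w ^ 2) * Real.exp (a * t) * Real.sin (w * t))) t := by
  have hl : ∀ c : ℝ, HasDerivAt (fun s : ℝ => c * s) c t := fun c => by
    simpa using (hasDerivAt_id t).const_mul c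
  have h := ((hl a).exp.mul (((hl w).cos.const_mul w).sub ((hl w).sin.const_mul a))).sub_const w
  refine h.congr_deriv ?_
  simp only [Pi.sub_apply]
  ring

lemma continuous_returnFun (a w : ℝ) : Continuous (returnFun a w) :=
  continuous_iff_continuousAt.2 fun t => (hasDerivAt_returnFun a w t).continuousAt

lemma strictAntiOn_returnFun {a w : ℝ} (hw : 0 < w) :
    StrictAntiOn (returnFun a w) (Icc 0 (π / w)) := by
  refine strictAntiOn_of_deriv_neg (convex_Icc _ _) (continuous_returnFun a w).continuousOn ?_
  intro t ht
  rw [interior_Icc, mem_Ioo, lt_div_iff₀ hw] at ht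
  have hs : 0 < Real.sin (w * t) :=
    Real.sin_pos_of_pos_of_lt_pi (mul_pos hw ht.1) (by linarith)
  rw [(hasDerivAt_returnFun a w t).deriv, neg_lt_zero]
  positivity

lemma strictMonoOn_returnFun {a w : ℝ} (hw : 0 < w) :
    StrictMonoOn (returnFun a w) (Icc (π / w) (2 * π / w)) := by
  refine strictMonoOn_of_deriv_pos (convex_Icc _ _) (continuous_returnFun a w).continuousOn ?_
  intro t ht
  rw [interior_Icc, mem_Ioo, lt_div_iff₀ hw, div_lt_iff₀ hw] at ht
  have hs : Real.sin (w * t) < 0 := by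
    rw [← Real.sin_sub_two_pi]
    exact Real.sin_neg_of_neg_of_neg_pi_lt (by linarith) (by linarith)
  have hp : 0 < (a ^ 2 + w ^ 2) * Real.exp (a * t) := by positivity
  rw [(hasDerivAt_returnFun a w t).deriv, neg_pos]
  exact mul_neg_of_pos_of_neg hp hs

lemma exists_isLeast_returnFun_eq_zero {a w : ℝ} (ha : 0 < a) (hw : 0 < w) :
    ∃ t ∈ Ioo (π / w) (2 * π / w), IsLeast {t : ℝ | 0 < t ∧ returnFun a w t = 0} t := by
  have hpos : 0 < π / w := by positivity
  have hle : π / w ≤ 2 * π / w := by gcongr; linarith [Real.pi_pos]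
  have hneg : ∀ t ∈ Ioc 0 (π / w), returnFun a w t < 0 := fun t ht => by
    have h := strictAntiOn_returnFun (a := a) hw (left_mem_Icc.2 hpos.le)
      (Ioc_subset_Icc_self ht) ht.1
    simpa [returnFun] using h
  have hend : 0 < returnFun a w (2 * π / w) := by
    have h1 : 1 < Real.exp (a * (2 * π / w)) := Real.one_lt_exp_iff.2 (by positivity)
    have h2 : w * (2 * π / w) = 2 * π := by field_simp
    rw [returnFun, h2, Real.cos_two_pi, Real.sin_two_pi]
    nlinarith
  obtain ⟨t, ht, h0⟩ := intermediate_value_Ioo hle (continuous_returnFun a w).continuousOn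
    ⟨hneg _ ⟨hpos, le_rfl⟩, hend⟩
  refine ⟨t, ht, ⟨hpos.trans ht.1, h0⟩, fun s ⟨hs, hs0⟩ => ?_⟩
  by_contra! hst
  rcases le_or_gt s (π / w) with h | h
  · exact (hneg s ⟨hs, h⟩).ne hs0
  · have := strictMonoOn_returnFun (a := a) hw ⟨h.le, (hst.trans ht.2).le⟩
      (Ioo_subset_Icc_self ht) hst
    linarith

lemma Ysol_eq_zero_iff_s9 {a ω xi : ℝ} (hω : 0 < ω) (hxi : Real.sin (ω * π * xi) = 0) (x : ℝ) :
    Ysol a ω xi x = 0 ↔ returnFun a (ω * π) (x - xi) = 0 := by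
  have hden : ω ^ 2 * π ^ 2 + a ^ 2 ≠ 0 := by positivity
  have hc : Real.cos (ω * π * xi) ≠ 0 := fun h => by
    simpa [h, hxi] using Real.sin_sq_add_cos_sq (ω * π * xi)
  have hx : ω * π * x = ω * π * (x - xi) + ω * π * xi := by ring
  have hexp : Real.exp (-a * (x - xi)) * Real.exp (a * (x - xi)) = 1 := by
    rw [← Real.exp_add, ← Real.exp_zero]; ring_nf
  have key : ω * π * Real.cos (ω * π * x) - a * Real.sin (ω * π * x)
      + Real.exp (-a * (x - xi)) * (a * Real.sin (ω * π * xi) - ω * π * Real.cos (ω * π * xi))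
      = Real.cos (ω * π * xi) * Real.exp (-a * (x - xi)) * returnFun a (ω * π) (x - xi) := by
    rw [hx, Real.cos_add, Real.sin_add, hxi, returnFun]
    linear_combination (-Real.cos (ω * π * xi) * (ω * π * Real.cos (ω * π * (x - xi))
      - a * Real.sin (ω * π * (x - xi)))) * hexp
  rw [Ysol, key]
  simp [hden, hc, Real.exp_ne_zero]

/-- The first-return point exists and lies between one half period and one full period of the
forcing, whenever the solution starts at a zero of the forcing. -/
lemma firstReturn_bounds {a ω xi : ℝ} (ha : 0 < a) (hω : 0 < ω)
    (hxi : Real.sin (ω * π * xi) = 0) :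
    IsLeast {x : ℝ | xi < x ∧ Ysol a ω xi x = 0} (sInf {x : ℝ | xi < x ∧ Ysol a ω xi x = 0}) ∧
      sInf {x : ℝ | xi < x ∧ Ysol a ω xi x = 0} ∈ Ioo (xi + 1 / ω) (xi + 2 / ω) := by
  obtain ⟨t, ⟨ht1, ht2⟩, ⟨ht, h0⟩, hmin⟩ :=
    exists_isLeast_returnFun_eq_zero ha (mul_pos hω Real.pi_pos)
  have h1 : π / (ω * π) = 1 / ω := by field_simp
  have h2 : 2 * π / (ω * π) = 2 / ω := by field_simp
  have hL : IsLeast {x : ℝ | xi < x ∧ Ysol a ω xi x = 0} (xi + t) := by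
    refine ⟨⟨by linarith, (Ysol_eq_zero_iff_s9 hω hxi _).2 (by simpa using h0)⟩, ?_⟩
    rintro x ⟨hx, hx0⟩
    have := hmin ⟨sub_pos.2 hx, (Ysol_eq_zero_iff_s9 hω hxi x).1 hx0⟩
    linarith
  rw [hL.csInf_eq]
  exact ⟨hL, by linarith, by linarith⟩

/-- for every `a > 0`, (i) for every integer `n ≥ 1` the
first-return point `P₊ᵃ(4n−2)` exists and lies in `(4n − 4/3, 4n − 2/3)`;
(ii) for every `n ∈ ℕ` the first-return point `P₋ᵃ(4n)` exists and lies in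
`(4n + 2, 4n + 4)`. -/
theorem first_return_bounds_nonlinear (a : ℝ) (ha : 0 < a) :
    (∀ n : ℕ, 1 ≤ n →
      IsLeast {x : ℝ | (4 * n - 2 : ℝ) < x ∧ Ysol a (3 / 2) (4 * n - 2) x = 0}
        (Pp a (4 * n - 2)) ∧
      Pp a (4 * n - 2) ∈ Set.Ioo (4 * n - 4 / 3 : ℝ) (4 * n - 2 / 3)) ∧
    (∀ n : ℕ,
      IsLeast {x : ℝ | (4 * n : ℝ) < x ∧ Ysol a (1 / 2) (4 * n) x = 0} (Pm a (4 * n)) ∧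
      Pm a (4 * n) ∈ Set.Ioo (4 * n + 2 : ℝ) (4 * n + 4)) := by
  refine ⟨fun n _ => ?_, fun n => ?_⟩
  · have hs : Real.sin (3 / 2 * π * (4 * n - 2)) = 0 :=
      Real.sin_eq_zero_iff.2 ⟨6 * n - 3, by push_cast; ring⟩
    obtain ⟨hL, h1, h2⟩ := firstReturn_bounds ha (by norm_num) hs
    change _ < Pp a (4 * n - 2) at h1
    change Pp a (4 * n - 2) < _ at h2
    exact ⟨hL, by linarith, by linarith⟩
  · have hs : Real.sin (1 / 2 * π * (4 * n)) = 0 :=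
      Real.sin_eq_zero_iff.2 ⟨2 * n, by push_cast; ring⟩
    obtain ⟨hL, h1, h2⟩ := firstReturn_bounds ha (by norm_num) hs
    change _ < Pm a (4 * n) at h1
    change Pm a (4 * n) < _ at h2
    exact ⟨hL, by linarith, by linarith⟩
end

section
/- For every a > 0 set x_a := min{x > 0 : Y_{a,1/2,0}(x) = 0}. Then x_a ∈ (2, 4), and the function y_d : [0,∞) → ℝ defined by y_d(x) = Y_{a,1/2,4n}(x) for x ∈ [4n, 4n + x_a] and y_d(x) = 0 for x ∈ [4n + x_a, 4(n+1)] (n ∈ ℕ) is well defined, continuous and 4-periodic, satisfies y_d(x) < 0 and y_d′(x) = −a·y_d(x) − sin(πx/2) for x ∈ (4n, 4n + x_a), and for every x > 0 with y_d(x) = 0 there exists λ ∈ (−1, 1) with sin(πx·(1 + λ/2)) = 0 (the sliding condition). Moreover y_d is the unique continuous 4-periodic function [0,∞) → (−∞, 0] with these properties, i.e. the unique sliding 4-periodic solution of the nonlinear switching system lying in the closed lower half-plane. -/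
open Real Set

theorem Ysol_half_hasDerivAt (a xi x : ℝ) :
    HasDerivAt (Ysol a (1 / 2) xi) (-a * Ysol a (1 / 2) xi x - Real.sin (π * x / 2)) x := by
  have hD : ((1 / 2 : ℝ) ^ 2 * π ^ 2 + a ^ 2) ≠ 0 := by positivity
  have h0 : HasDerivAt (fun y : ℝ => 1 / 2 * π * y) (1 / 2 * π) x := by
    simpa using (hasDerivAt_id x).const_mul (1 / 2 * π)
  have h1 : HasDerivAt (fun y : ℝ => -a * (y - xi)) (-a) x := by
    simpa using ((hasDerivAt_id x).sub_const xi).const_mul (-a)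
  have h := (((h0.cos.const_mul (1 / 2 * π)).sub (h0.sin.const_mul a)).add
    (h1.exp.mul_const (a * Real.sin (1 / 2 * π * xi) - 1 / 2 * π * Real.cos (1 / 2 * π * xi)))
    ).div_const ((1 / 2 : ℝ) ^ 2 * π ^ 2 + a ^ 2)
  refine h.congr_deriv ?_
  have hs : π * x / 2 = 1 / 2 * π * x := by ring
  rw [hs]
  unfold Ysol
  field_simp
  ring

theorem Ysol_half_four_mul (a : ℝ) (n : ℕ) (x : ℝ) :
    Ysol a (1 / 2) (4 * n) x = Ysol a (1 / 2) 0 (x - 4 * n) := by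
  have h1 : 1 / 2 * π * (x - 4 * n) = 1 / 2 * π * x - n * (2 * π) := by ring
  have h2 : 1 / 2 * π * (4 * n) = n * (2 * π) := by ring
  unfold Ysol
  rw [h1, h2, Real.cos_sub_nat_mul_two_pi, Real.sin_sub_nat_mul_two_pi, Real.cos_nat_mul_two_pi,
    ← zero_add ((n : ℝ) * (2 * π)), Real.sin_add_nat_mul_two_pi]
  simp

theorem Ysol_self_zero (a : ℝ) : Ysol a (1 / 2) 0 0 = 0 := by
  simp [Ysol]

theorem Ysol_four_pos {a : ℝ} (ha : 0 < a) : 0 < Ysol a (1 / 2) 0 4 := by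
  have h : 1 / 2 * π * 4 = 2 * π := by ring
  have he : Real.exp (-a * (4 - 0)) < 1 := by
    rw [Real.exp_lt_one_iff]; linarith
  unfold Ysol
  rw [h]
  apply div_pos _ (by positivity)
  simp only [Real.cos_two_pi, Real.sin_two_pi, mul_zero, Real.sin_zero, Real.cos_zero]
  generalize Real.exp (-a * (4 - 0)) = e at he ⊢
  nlinarith [mul_pos Real.pi_pos (sub_pos.2 he)]

/-- Multiplication by the integrating factor removes the linear term of the ODE. -/
theorem hasDerivAt_exp_mul_of_linear {a x s : ℝ} {z : ℝ → ℝ}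
    (h : HasDerivAt z (-a * z x - s) x) :
    HasDerivAt (fun y => Real.exp (a * y) * z y) (-(Real.exp (a * x) * s)) x := by
  have h0 : HasDerivAt (fun y : ℝ => a * y) a x := by
    simpa using (hasDerivAt_id x).const_mul a
  refine (h0.exp.mul h).congr_deriv ?_
  ring

/-- The solution `Y_{a,1/2,0}` multiplied by the integrating factor `exp (a x)`. -/
noncomputable def expYsol (a x : ℝ) : ℝ := Real.exp (a * x) * Ysol a (1 / 2) 0 x

theorem expYsol_hasDerivAt (a x : ℝ) :
    HasDerivAt (expYsol a) (-(Real.exp (a * x) * Real.sin (π * x / 2))) x :=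
  hasDerivAt_exp_mul_of_linear (Ysol_half_hasDerivAt a 0 x)

theorem expYsol_continuous (a : ℝ) : Continuous (expYsol a) :=
  continuous_iff_continuousAt.2 fun x => (expYsol_hasDerivAt a x).continuousAt

theorem expYsol_strictAntiOn (a : ℝ) : StrictAntiOn (expYsol a) (Icc 0 2) := by
  refine strictAntiOn_of_deriv_neg (convex_Icc 0 2) (expYsol_continuous a).continuousOn ?_
  intro x hx
  rw [interior_Icc] at hx
  rw [(expYsol_hasDerivAt a x).deriv, neg_lt_zero]
  refine mul_pos (Real.exp_pos _) (Real.sin_pos_of_pos_of_lt_pi ?_ ?_) <;>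
    nlinarith [hx.1, hx.2, Real.pi_pos]

theorem expYsol_strictMonoOn (a : ℝ) : StrictMonoOn (expYsol a) (Icc 2 4) := by
  refine strictMonoOn_of_deriv_pos (convex_Icc 2 4) (expYsol_continuous a).continuousOn ?_
  intro x hx
  rw [interior_Icc] at hx
  rw [(expYsol_hasDerivAt a x).deriv, neg_pos]
  refine mul_neg_of_pos_of_neg (Real.exp_pos _) ?_
  have h : Real.sin (π * x / 2) = -Real.sin (π * x / 2 - π) := by rw [Real.sin_sub_pi]; ring
  rw [h, neg_lt_zero]
  refine Real.sin_pos_of_pos_of_lt_pi ?_ ?_ <;> nlinarith [hx.1, hx.2, Real.pi_pos]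

theorem expYsol_zero (a : ℝ) : expYsol a 0 = 0 := by
  rw [expYsol, Ysol_self_zero, mul_zero]

theorem expYsol_four_pos {a : ℝ} (ha : 0 < a) : 0 < expYsol a 4 :=
  mul_pos (Real.exp_pos _) (Ysol_four_pos ha)

theorem expYsol_eq_zero_iff {a x : ℝ} : expYsol a x = 0 ↔ Ysol a (1 / 2) 0 x = 0 := by
  simp [expYsol, Real.exp_ne_zero]

theorem expYsol_neg_of_le_two {a x : ℝ} (h0 : 0 < x) (h2 : x ≤ 2) : expYsol a x < 0 := by
  have := expYsol_strictAntiOn a ⟨le_rfl, by norm_num⟩ ⟨h0.le, h2⟩ h0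
  rwa [expYsol_zero] at this

/-- The first return time of the lower solution starting at the origin lies in `(2, 4)`. -/
theorem exists_first_return {a : ℝ} (ha : 0 < a) :
    ∃ xa ∈ Ioo (2 : ℝ) 4, expYsol a xa = 0 ∧ (∀ x, 0 < x → x < xa → expYsol a x < 0) ∧
      ∀ x, xa ≤ x → x ≤ 4 → 0 ≤ expYsol a x := by
  have h2 : expYsol a 2 < 0 := expYsol_neg_of_le_two (by norm_num) le_rfl
  obtain ⟨xa, hxa, h0⟩ := intermediate_value_Ioo (by norm_num : (2 : ℝ) ≤ 4)
    (expYsol_continuous a).continuousOn ⟨h2, expYsol_four_pos ha⟩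
  have hmem : xa ∈ Icc (2 : ℝ) 4 := ⟨hxa.1.le, hxa.2.le⟩
  refine ⟨xa, hxa, h0, fun x hx hlt => ?_, fun x hx hx4 => ?_⟩
  · rcases le_total x 2 with h | h
    · exact expYsol_neg_of_le_two hx h
    · have := expYsol_strictMonoOn a ⟨h, by linarith [hxa.2]⟩ hmem hlt
      rwa [h0] at this
  · have := (expYsol_strictMonoOn a).monotoneOn hmem ⟨by linarith [hxa.1], hx4⟩ hx
    rwa [h0] at this

theorem exists_sliding_parameter {x : ℝ} (hx : 1 < x) :
    ∃ lam ∈ Ioo (-1 : ℝ) 1, Real.sin (π * x * (1 + lam / 2)) = 0 := by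
  have hx0 : x ≠ 0 := by linarith
  have hf1 := Int.floor_le (x / 2)
  have hf2 := Int.lt_floor_add_one (x / 2)
  set k : ℤ := ⌊x / 2⌋ with hk
  refine ⟨2 * ((k + 1) / x - 1), ⟨?_, ?_⟩, ?_⟩
  · have : 1 / 2 < ((k : ℝ) + 1) / x := by rw [lt_div_iff₀ (by linarith)]; linarith
    linarith
  · have : ((k : ℝ) + 1) / x < 3 / 2 := by rw [div_lt_iff₀ (by linarith)]; linarith
    linarith
  · have : π * x * (1 + 2 * (((k : ℝ) + 1) / x - 1) / 2) = ((k + 1 : ℤ) : ℝ) * π := by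
      push_cast
      field_simp
      ring
    rw [this, Real.sin_int_mul_pi]

theorem no_sliding_parameter {x lam : ℝ} (hx : 0 < x) (hx' : x ≤ 2 / 3)
    (hlam : lam ∈ Ioo (-1 : ℝ) 1) : Real.sin (π * x * (1 + lam / 2)) ≠ 0 := by
  obtain ⟨h1, h2⟩ := hlam
  have hlow : 0 < x * (1 + lam / 2) := mul_pos hx (by linarith)
  have hup : x * (1 + lam / 2) < 1 := by nlinarith
  rw [mul_assoc]
  refine (Real.sin_pos_of_pos_of_lt_pi (mul_pos Real.pi_pos hlow) ?_).ne'
  nlinarith [Real.pi_pos]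

/-- On an interval where `z` solves the lower equation, its increments (after multiplication by
the integrating factor) agree with those of the reference solution. -/
theorem exp_mul_sub_eq_expYsol_sub {a p q : ℝ} {z : ℝ → ℝ} (hpq : p ≤ q)
    (hc : ContinuousOn z (Icc p q))
    (hd : ∀ x ∈ Ioo p q, HasDerivAt z (-a * z x - Real.sin (π * x / 2)) x) :
    Real.exp (a * q) * z q - Real.exp (a * p) * z p = expYsol a q - expYsol a p := by
  rcases hpq.eq_or_lt with rfl | hlt
  · simp
  have hcont : ContinuousOn (fun x => Real.exp (a * x) * z x - expYsol a x) (Icc p q) :=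
    ((by fun_prop : Continuous fun x : ℝ => Real.exp (a * x)).continuousOn.mul hc).sub
      (expYsol_continuous a).continuousOn
  obtain ⟨c, -, hc0⟩ := exists_hasDerivAt_eq_slope _ (fun _ => 0) hlt hcont fun x hx =>
    ((hasDerivAt_exp_mul_of_linear (hd x hx)).sub (expYsol_hasDerivAt a x)).congr_deriv
      (sub_self _)
  rw [eq_comm, div_eq_zero_iff] at hc0
  rcases hc0 with h | h <;> linarith

theorem exists_last_zero {z : ℝ → ℝ} {l r c : ℝ} (hz : ContinuousOn z (Icc l r))
    (hc : c ∈ Icc l r) (hc0 : z c = 0) :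
    ∃ p ∈ Icc l r, z p = 0 ∧ ∀ x, p < x → x ≤ r → z x ≠ 0 := by
  have hK : IsCompact (Icc l r ∩ z ⁻¹' {0}) :=
    isCompact_Icc.of_isClosed_subset (hz.preimage_isClosed_of_isClosed isClosed_Icc
      isClosed_singleton) inter_subset_left
  obtain ⟨p, ⟨hp, hp0⟩, hmax⟩ := hK.exists_isGreatest ⟨c, hc, hc0⟩
  exact ⟨p, hp, hp0, fun x hx hxr h0 =>
    absurd (hmax ⟨⟨hp.1.trans hx.le, hxr⟩, h0⟩) (not_le.2 hx)⟩

theorem exists_first_zero {z : ℝ → ℝ} {l r c : ℝ} (hz : ContinuousOn z (Icc l r))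
    (hc : c ∈ Icc l r) (hc0 : z c = 0) :
    ∃ p ∈ Icc l r, z p = 0 ∧ ∀ x, l ≤ x → x < p → z x ≠ 0 := by
  have hK : IsCompact (Icc l r ∩ z ⁻¹' {0}) :=
    isCompact_Icc.of_isClosed_subset (hz.preimage_isClosed_of_isClosed isClosed_Icc
      isClosed_singleton) inter_subset_left
  obtain ⟨p, ⟨hp, hp0⟩, hmin⟩ := hK.exists_isLeast ⟨c, hc, hc0⟩
  exact ⟨p, hp, hp0, fun x hx hxr h0 =>
    absurd (hmin ⟨⟨hx, hxr.le.trans hp.2⟩, h0⟩) (not_le.2 hxr)⟩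

/-- A nonpositive 4-periodic solution vanishes at the multiples of the period. -/
theorem eq_zero_at_four {a : ℝ} (ha : 0 < a) {z : ℝ → ℝ} (hc : ContinuousOn z (Ici (0 : ℝ)))
    (hper : z 4 = z 0) (hle : ∀ x : ℝ, 0 ≤ x → z x ≤ 0)
    (hd : ∀ x : ℝ, 0 < x → z x < 0 → HasDerivAt z (-a * z x - Real.sin (π * x / 2)) x) :
    z 4 = 0 := by
  by_contra hne
  have h4 : z 4 < 0 := lt_of_le_of_ne (hle 4 (by norm_num)) hne
  have hcI : ∀ {l r : ℝ}, 0 ≤ l → ContinuousOn z (Icc l r) := fun hl =>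
    hc.mono fun x hx => hl.trans hx.1
  have hw4 : Real.exp (a * 4) * z 4 < 0 := mul_neg_of_pos_of_neg (Real.exp_pos _) h4
  have hG4 := expYsol_four_pos ha
  by_cases hex : ∃ c ∈ Icc (0 : ℝ) 4, z c = 0
  · obtain ⟨c, hcm, hc0⟩ := hex
    obtain ⟨p, hp, hp0, hlast⟩ := exists_last_zero (hcI le_rfl) hcm hc0
    have hinc := exp_mul_sub_eq_expYsol_sub (a := a) hp.2 (hcI hp.1) fun x hx =>
      hd x (hp.1.trans_lt hx.1)
        (lt_of_le_of_ne (hle x (hp.1.trans hx.1.le)) (hlast x hx.1 hx.2.le))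
    rw [hp0, mul_zero, sub_zero] at hinc
    rcases le_total p 2 with h | h
    · have : expYsol a p ≤ 0 := by
        rcases hp.1.eq_or_lt with rfl | h0
        · exact (expYsol_zero a).le
        · exact (expYsol_neg_of_le_two h0 h).le
      linarith
    · have := (expYsol_strictMonoOn a).monotoneOn ⟨h, hp.2⟩ ⟨by norm_num, le_rfl⟩ hp.2
      linarith
  · push Not at hex
    have hinc := exp_mul_sub_eq_expYsol_sub (a := a) (by norm_num : (0 : ℝ) ≤ 4) (hcI le_rfl)
      fun x hx => hd x hx.1 (lt_of_le_of_ne (hle x hx.1.le) (hex x ⟨hx.1.le, hx.2.le⟩))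
    have he : 1 < Real.exp (a * 4) := Real.one_lt_exp_iff.2 (by linarith)
    rw [mul_zero, Real.exp_zero, one_mul, ← hper, expYsol_zero, sub_zero] at hinc
    nlinarith

/-- On one period a nonpositive 4-periodic sliding solution is the negative part of the lower
solution starting at the origin. -/
theorem sliding_solution_eq_min {a : ℝ} (ha : 0 < a) {z : ℝ → ℝ}
    (hc : ContinuousOn z (Ici (0 : ℝ)))
    (hper : z 4 = z 0) (hle : ∀ x : ℝ, 0 ≤ x → z x ≤ 0)
    (hd : ∀ x : ℝ, 0 < x → z x < 0 → HasDerivAt z (-a * z x - Real.sin (π * x / 2)) x)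
    (hs : ∀ x : ℝ, 0 < x → z x = 0 →
      ∃ lam ∈ Ioo (-1 : ℝ) 1, Real.sin (π * x * (1 + lam / 2)) = 0)
    {x : ℝ} (hx : x ∈ Icc (0 : ℝ) 4) : z x = min (Ysol a (1 / 2) 0 x) 0 := by
  have hcI : ∀ {l r : ℝ}, 0 ≤ l → ContinuousOn z (Icc l r) := fun hl =>
    hc.mono fun x hx => hl.trans hx.1
  have hz4 := eq_zero_at_four ha hc hper hle hd
  have hz0 : z 0 = 0 := hper ▸ hz4
  obtain ⟨q, hq, hq0, hfirst⟩ := exists_first_zero (l := 2 / 3) (r := 4) (hcI (by norm_num))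
    ⟨by norm_num, le_rfl⟩ hz4
  have hqpos : 0 < q := lt_of_lt_of_le (by norm_num) hq.1
  have hneg : ∀ y, 0 < y → y < q → z y < 0 := by
    intro y hy hyq
    refine lt_of_le_of_ne (hle y hy.le) fun h0 => ?_
    rcases le_total y (2 / 3) with h | h
    · obtain ⟨lam, hlam, hsin⟩ := hs y hy h0
      exact no_sliding_parameter hy h hlam hsin
    · exact hfirst y h hyq h0
  have hfollow : ∀ y ∈ Icc 0 q, Real.exp (a * y) * z y = expYsol a y := by
    intro y hy
    have hinc := exp_mul_sub_eq_expYsol_sub (a := a) hy.1 (hcI le_rfl) fun t ht =>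
      hd t ht.1 (hneg t ht.1 (ht.2.trans_le hy.2))
    simpa [hz0, expYsol_zero] using hinc
  have hGq : expYsol a q = 0 := by rw [← hfollow q ⟨hqpos.le, le_rfl⟩, hq0, mul_zero]
  have hq2 : 2 < q := by
    by_contra h
    exact (expYsol_neg_of_le_two hqpos (not_lt.1 h)).ne hGq
  rcases le_total x q with hxq | hxq
  · have hzx : z x = Ysol a (1 / 2) 0 x :=
      mul_left_cancel₀ (Real.exp_ne_zero (a * x)) (hfollow x ⟨hx.1, hxq⟩)
    rw [← hzx, min_eq_left (hle x hx.1)]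
  · have hGx : 0 ≤ expYsol a x := hGq ▸ (expYsol_strictMonoOn a).monotoneOn
      ⟨hq2.le, hq.2⟩ ⟨hq2.le.trans hxq, hx.2⟩ hxq
    rw [min_eq_right (nonneg_of_mul_nonneg_right hGx (Real.exp_pos _))]
    by_contra hne
    have hxneg := lt_of_le_of_ne (hle x hx.1) hne
    obtain ⟨p, hp, hp0, hlast⟩ := exists_last_zero (l := q) (r := x) (hcI hqpos.le)
      ⟨le_rfl, hxq⟩ hq0
    have hp2 : 2 ≤ p := hq2.le.trans hp.1
    have hinc := exp_mul_sub_eq_expYsol_sub (a := a) hp.2 (hcI (by linarith)) fun y hy =>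
      hd y (by linarith [hy.1])
        (lt_of_le_of_ne (hle y (by linarith [hy.1])) (hlast y hy.1 hy.2.le))
    have hmono := (expYsol_strictMonoOn a).monotoneOn ⟨hp2, hp.2.trans hx.2⟩
      ⟨hp2.trans hp.2, hx.2⟩ hp.2
    have := mul_neg_of_pos_of_neg (Real.exp_pos (a * x)) hxneg
    rw [hp0, mul_zero, sub_zero] at hinc
    linarith

/-- The 4-periodic extension of the negative part of the lower solution starting at the origin. -/
noncomputable def slidingSol (a x : ℝ) : ℝ :=
  min (Ysol a (1 / 2) 0 (4 * Int.fract (x / 4))) 0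

theorem slidingSol_continuous {a : ℝ} (ha : 0 < a) : Continuous (slidingSol a) := by
  have hY : Continuous (Ysol a (1 / 2) 0) :=
    continuous_iff_continuousAt.2 fun x => (Ysol_half_hasDerivAt a 0 x).continuousAt
  have h : Continuous ((fun t : ℝ => min (Ysol a (1 / 2) 0 (4 * t)) 0) ∘ Int.fract) := by
    refine ContinuousOn.comp_fract'' (by fun_prop) ?_
    simp only [mul_zero, mul_one, Ysol_self_zero, min_self]
    rw [min_eq_right (Ysol_four_pos ha).le]
  exact h.comp (continuous_id.div_const 4)

theorem slidingSol_add_four (a x : ℝ) : slidingSol a (x + 4) = slidingSol a x := by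
  simp [slidingSol, add_div]

theorem slidingSol_eq_min {a : ℝ} (ha : 0 < a) (n : ℕ) {x : ℝ}
    (hx : x ∈ Icc (4 * n : ℝ) (4 * n + 4)) :
    slidingSol a x = min (Ysol a (1 / 2) 0 (x - 4 * n)) 0 := by
  rcases hx.2.eq_or_lt with h | h
  · have hx4 : x / 4 = ((n + 1 : ℕ) : ℝ) := by rw [h]; push_cast; ring
    have hsub : x - 4 * n = 4 := by linarith
    rw [slidingSol, hx4, Int.fract_natCast, hsub, mul_zero, Ysol_self_zero,
      min_eq_right (Ysol_four_pos ha).le, min_self]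
  · have hf : Int.fract (x / 4) = x / 4 - n := by
      rw [Int.fract_eq_iff]
      exact ⟨by linarith [hx.1], by linarith, n, by push_cast; ring⟩
    rw [slidingSol, hf]
    congr 2
    ring

theorem exists_nat_mem_Ico_four {x : ℝ} (hx : 0 ≤ x) :
    ∃ n : ℕ, x ∈ Ico (4 * n : ℝ) (4 * n + 4) := by
  have h1 := Nat.floor_le (by positivity : 0 ≤ x / 4)
  have h2 := Nat.lt_floor_add_one (x / 4)
  exact ⟨⌊x / 4⌋₊, by linarith, by linarith⟩

theorem periodic_four_add {z : ℝ → ℝ} (hper : ∀ x : ℝ, 0 ≤ x → z (x + 4) = z x) (n : ℕ) :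
    ∀ x : ℝ, 0 ≤ x → z (x + 4 * n) = z x := by
  induction n with
  | zero => simp
  | succ k ih =>
    intro x hx
    rw [← ih x hx, ← hper (x + 4 * k) (by positivity)]
    congr 1
    push_cast
    ring

/-- the nonlinear switching system has a unique sliding
4-periodic solution `y_d` lying in the closed lower half-plane: with
`x_a := min{x > 0 : Y_{a,1/2,0}(x) = 0} ∈ (2,4)`, `y_d` equals the lower
half-plane solution on `[4n, 4n + x_a]` and `0` on `[4n + x_a, 4(n+1)]`;
it is continuous, 4-periodic, negative and solves the lower ODE on
`(4n, 4n + x_a)`, its zeros satisfy the sliding condition, and it is the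
unique nonpositive continuous 4-periodic function with these properties. -/
theorem unique_sliding_four_periodic_solution (a : ℝ) (ha : 0 < a) :
    ∃ xa : ℝ, IsLeast {x : ℝ | 0 < x ∧ Ysol a (1 / 2) 0 x = 0} xa ∧
      xa ∈ Set.Ioo (2 : ℝ) 4 ∧
      ∃ yd : ℝ → ℝ,
        ContinuousOn yd (Set.Ici (0 : ℝ)) ∧
        (∀ x : ℝ, 0 ≤ x → yd (x + 4) = yd x) ∧
        (∀ n : ℕ, ∀ x ∈ Set.Icc (4 * n : ℝ) (4 * n + xa), yd x = Ysol a (1 / 2) (4 * n) x) ∧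
        (∀ n : ℕ, ∀ x ∈ Set.Icc (4 * n + xa : ℝ) (4 * (n + 1) : ℝ), yd x = 0) ∧
        (∀ n : ℕ, ∀ x ∈ Set.Ioo (4 * n : ℝ) (4 * n + xa),
          yd x < 0 ∧ HasDerivAt yd (-a * yd x - Real.sin (π * x / 2)) x) ∧
        (∀ x : ℝ, 0 < x → yd x = 0 →
          ∃ lam ∈ Set.Ioo (-1 : ℝ) 1, Real.sin (π * x * (1 + lam / 2)) = 0) ∧
        (∀ z : ℝ → ℝ,
          ContinuousOn z (Set.Ici (0 : ℝ)) →
          (∀ x : ℝ, 0 ≤ x → z (x + 4) = z x) →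
          (∀ x : ℝ, 0 ≤ x → z x ≤ 0) →
          (∀ x : ℝ, 0 < x → z x < 0 → HasDerivAt z (-a * z x - Real.sin (π * x / 2)) x) →
          (∀ x : ℝ, 0 < x → z x = 0 →
            ∃ lam ∈ Set.Ioo (-1 : ℝ) 1, Real.sin (π * x * (1 + lam / 2)) = 0) →
          ∀ x : ℝ, 0 ≤ x → z x = yd x) := by
  obtain ⟨xa, hxa, h0, hneg, hnonneg⟩ := exists_first_return ha
  obtain ⟨hxa2, hxa4⟩ := hxa
  have hYneg : ∀ x, 0 < x → x < xa → Ysol a (1 / 2) 0 x < 0 := fun x hx hlt =>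
    neg_of_mul_neg_right (hneg x hx hlt) (Real.exp_pos _).le
  have hYnonneg : ∀ x, xa ≤ x → x ≤ 4 → 0 ≤ Ysol a (1 / 2) 0 x := fun x hx hx4 =>
    nonneg_of_mul_nonneg_right (hnonneg x hx hx4) (Real.exp_pos _)
  have hYxa : Ysol a (1 / 2) 0 xa = 0 := expYsol_eq_zero_iff.1 h0
  have hlower : ∀ n : ℕ, ∀ x ∈ Set.Icc (4 * n : ℝ) (4 * n + xa),
      slidingSol a x = Ysol a (1 / 2) (4 * n) x := by
    intro n x hx
    rw [slidingSol_eq_min ha n ⟨hx.1, by linarith [hx.2]⟩, Ysol_half_four_mul]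
    refine min_eq_left ?_
    rcases hx.1.eq_or_lt with h | h
    · rw [← h, sub_self, Ysol_self_zero]
    rcases hx.2.eq_or_lt with h' | h'
    · rw [h', add_sub_cancel_left, hYxa]
    · exact (hYneg _ (by linarith) (by linarith)).le
  have hlower_neg : ∀ n : ℕ, ∀ x ∈ Set.Ioo (4 * n : ℝ) (4 * n + xa), slidingSol a x < 0 := by
    intro n x hx
    rw [hlower n x (Ioo_subset_Icc_self hx), Ysol_half_four_mul]
    exact hYneg _ (by linarith [hx.1]) (by linarith [hx.2])
  refine ⟨xa, ⟨⟨by linarith, hYxa⟩, fun x hx => ?_⟩, ⟨hxa2, hxa4⟩, slidingSol a,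
    (slidingSol_continuous ha).continuousOn, fun x _ => slidingSol_add_four a x, hlower,
    ?_, ?_, ?_, ?_⟩
  · by_contra h
    exact (hYneg x hx.1 (not_le.1 h)).ne hx.2
  · intro n x hx
    rw [slidingSol_eq_min ha n ⟨by linarith [hx.1], by linarith [hx.2]⟩]
    exact min_eq_right (hYnonneg _ (by linarith [hx.1]) (by linarith [hx.2]))
  · intro n x hx
    refine ⟨hlower_neg n x hx, ?_⟩
    rw [hlower n x (Ioo_subset_Icc_self hx)]
    refine (Ysol_half_hasDerivAt a (4 * n) x).congr_of_eventuallyEq ?_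
    filter_upwards [Ioo_mem_nhds hx.1 hx.2] with y hy
    exact hlower n y (Ioo_subset_Icc_self hy)
  · intro x hx hx0
    refine exists_sliding_parameter ?_
    by_contra h
    refine (hlower_neg 0 x ⟨?_, ?_⟩).ne hx0 <;> push_cast <;> linarith
  · intro z hc hper hle hd hs x hx
    obtain ⟨n, hn⟩ := exists_nat_mem_Ico_four hx
    rw [slidingSol_eq_min ha n (Ico_subset_Icc_self hn)]
    have hr : x - 4 * n ∈ Icc (0 : ℝ) 4 := ⟨by linarith [hn.1], by linarith [hn.2]⟩
    have hz : z x = z (x - 4 * n) := by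
      rw [← periodic_four_add hper n _ hr.1, sub_add_cancel]
    rw [hz, sliding_solution_eq_min ha hc (by simpa using hper 0 le_rfl) hle hd hs hr]
end
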